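/- arXiv:2311.05246 — 2 statements merged into one kernel-verified Lean document; each statement's English description precedes it below -/
import Mathlib

section
/- Let W be a suitable basis of A at {β₁,…,β_I}, and let e ∈ C[x] and M ∈ C[x]^{r×r} be such that SW = (1/e)·MW and the gcd of e together with all entries of M equals 1. Then for every f ∈ A there exist g ∈ A, a nonzero d ∈ C[x], and P, R ∈ C[x]^r such that f = Δg + (1/d)·PW + (1/e)·RW, every entry of P has degree strictly less than deg d, the polynomial d·∏_{i=1}^I (x−β_i) ∈ C̄[x] is shift-free, and moreover, if f is summable in A then P = 0. -/
set_option maxHeartbeats 1000000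
set_option synthInstance.maxHeartbeats 200000

open Polynomial Filter

noncomputable section

namespace PRec

variable (C : Type*) [Field C] [CharZero C]

/-- The algebraic closure of the coefficient field. -/
abbrev Cbar := AlgebraicClosure C

/-- The field of formal Laurent series over the algebraic closure. -/
abbrev LS := LaurentSeries (Cbar C)

/-- The Laurent-series variable `q`. -/
def qv : LS C := HahnSeries.single 1 1

open Classical in
/-- The valuation `ν_q`, with `ν_q 0 = ⊤`, valued in the extended reals. -/
def nuq (a : LS C) : EReal := if a = 0 then ⊤ else (((a.order : ℤ) : ℝ) : EReal)

/-- Evaluation of a rational function at the point `α + m + q`. -/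
def evalAt (α : Cbar C) (m : ℤ) (p : RatFunc C) : LS C :=
  RatFunc.eval ((algebraMap (Cbar C) (LS C)).comp (algebraMap C (Cbar C)))
    (algebraMap (Cbar C) (LS C) α + (m : LS C) + qv C) p

/-- Shorthand for the canonical map `C[x] → C(x)`. -/
abbrev toRat : Polynomial C →+* RatFunc C := algebraMap (Polynomial C) (RatFunc C)

variable (ℓ : ℕ → Polynomial C) (r : ℕ)

/-- The solution space `Sol_α(L)` of `L = ℓ₀ + ℓ₁ S + ⋯ + ℓ_r S^r` at `α`,
indexed so that `b n` stands for the value of the solution at `α + n`. -/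
def SolSet (α : Cbar C) : Set (ℤ → LS C) :=
  {b | ∀ n : ℤ, ∑ i ∈ Finset.range (r + 1),
      evalAt C α n (toRat C (ℓ i)) * b (n + i) = 0}

/-- The action of an element `f = f₀ + f₁ S + ⋯ + f_{r-1} S^{r-1}` of
`A = C(x)[S]/⟨L⟩` (represented by its coefficient vector) on a sequence. -/
def elemApply (α : Cbar C) (f : Fin r → RatFunc C) (b : ℤ → LS C) : ℤ → LS C :=
  fun n => ∑ i : Fin r, evalAt C α n (f i) * b (n + (i : ℤ))

/-- Truncated subtraction on extended reals with the convention `⊤ - ⊤ = ⊤`. -/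
def esub (a b : EReal) : EReal := if b = ⊤ then ⊤ else a - b

/-- The value function `val_α` on `A`. -/
def valAt (α : Cbar C) (f : Fin r → RatFunc C) : EReal :=
  ⨅ b ∈ SolSet C ℓ r α,
    esub (nuq C (elemApply C r α f b 0))
      (Filter.liminf (fun n : ℕ => nuq C (b (-(n : ℤ)))) Filter.atTop)

/-- `f ∈ A` is (locally) integral at `α`. -/
def IntegralAt (α : Cbar C) (f : Fin r → RatFunc C) : Prop :=
  0 ≤ valAt C ℓ r α f

/-- Membership in the local subring `C(x)_α` of rational functions having no pole at `α`. -/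
def InLocalRing (α : Cbar C) (f : RatFunc C) : Prop :=
  ∃ p q : Polynomial C, (Polynomial.aeval α) q ≠ 0 ∧ f = toRat C p / toRat C q

/-- `W` is a `C(x)`-vector space basis of `A` (represented on coefficient vectors). -/
def IsVSBasis (W : Fin r → (Fin r → RatFunc C)) : Prop :=
  LinearIndependent (RatFunc C) W ∧
    Submodule.span (RatFunc C) (Set.range W) = (⊤ : Submodule (RatFunc C) (Fin r → RatFunc C))

/-- The `C(x)_α`-span of a tuple of elements of `A`. -/
def localSpan (α : Cbar C) (W : Fin r → (Fin r → RatFunc C)) :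
    Set (Fin r → RatFunc C) :=
  {f | ∃ c : Fin r → RatFunc C, (∀ i, InLocalRing C α (c i)) ∧ f = ∑ i, c i • W i}

/-- `W` is a local integral basis of `A` at `α`. -/
def IsLocalIntegralBasis (α : Cbar C) (W : Fin r → (Fin r → RatFunc C)) : Prop :=
  IsVSBasis C r W ∧ (∀ i, IntegralAt C ℓ r α (W i)) ∧
    ∀ f : Fin r → RatFunc C, IntegralAt C ℓ r α f → f ∈ localSpan C r α W

/-- The standard basis `1, S, …, S^{r-1}` of `A`. -/
def stdBasis : Fin r → (Fin r → RatFunc C) :=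
  fun i j => if j = i then 1 else 0

/-- The shift automorphism `p(x) ↦ p(x+c)` of the polynomial ring. -/
def polyShiftEquiv (c : C) : Polynomial C ≃+* Polynomial C where
  toFun p := p.comp (X + Polynomial.C c)
  invFun p := p.comp (X - Polynomial.C c)
  left_inv p := by
    show (p.comp (X + Polynomial.C c)).comp (X - Polynomial.C c) = p
    rw [Polynomial.comp_assoc]; simp
  right_inv p := by
    show (p.comp (X - Polynomial.C c)).comp (X + Polynomial.C c) = p
    rw [Polynomial.comp_assoc]; simp
  map_add' p q := by simp [Polynomial.add_comp]
  map_mul' p q := by simp [Polynomial.mul_comp]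

/-- The shift `σ^k`, `p(x) ↦ p(x+k)`, on polynomials, for `k : ℤ`. -/
def polyShift (k : ℤ) (p : Polynomial C) : Polynomial C := polyShiftEquiv C (k : C) p

/-- `σ` on polynomials. -/
def polyσ : Polynomial C ≃+* Polynomial C := polyShiftEquiv C 1

/-- The shift automorphism `σ : f(x) ↦ f(x+1)` of the rational function field. -/
def ratσ : RatFunc C →+* RatFunc C :=
  RatFunc.mapRingHom (polyσ C : Polynomial C →+* Polynomial C)
    (by
      intro p hp
      simp only [Submonoid.mem_comap]
      refine mem_nonZeroDivisors_iff_ne_zero.mpr ?_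
      have hp0 : p ≠ 0 := mem_nonZeroDivisors_iff_ne_zero.mp hp
      simpa using (map_ne_zero_iff _ (polyσ C).injective).mpr hp0)

variable [NeZero r]

/-- The index `r - 1` as an element of `Fin r`. -/
def lastIdx : Fin r := ⟨r - 1, Nat.sub_lt (Nat.pos_of_ne_zero (NeZero.ne r)) one_pos⟩

/-- The action of `S` on `A = C(x)[S]/⟨L⟩`, on coefficient vectors with respect to the
basis `1, S, …, S^{r-1}`, using `S^r = -(ℓ₀/ℓ_r) - ⋯ - (ℓ_{r-1}/ℓ_r) S^{r-1}`. -/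
def Smap (f : Fin r → RatFunc C) : Fin r → RatFunc C :=
  fun j =>
    (if (j : ℕ) = 0 then 0 else
      ratσ C (f ⟨(j : ℕ) - 1, lt_of_le_of_lt (Nat.sub_le _ _) j.isLt⟩))
      - ratσ C (f (lastIdx r)) * (toRat C (ℓ j) / toRat C (ℓ r))

/-- The difference operator `Δ = S - 1` on `A`. -/
def Dmap (f : Fin r → RatFunc C) : Fin r → RatFunc C :=
  Smap C ℓ r f - f

/-- `f ∈ A` is summable. -/
def IsSummable (f : Fin r → RatFunc C) : Prop :=
  ∃ g : Fin r → RatFunc C, f = Dmap C ℓ r g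

/-- `disp_α(p) ≥ k`: `p` has two roots in `α + ℤ` at distance `k`. -/
def DispGe (α : Cbar C) (p : Polynomial (Cbar C)) (k : ℕ) : Prop :=
  ∃ m : ℤ, Polynomial.eval (α + (m : Cbar C)) p = 0 ∧
    Polynomial.eval (α + (m : Cbar C) + (k : Cbar C)) p = 0

/-- The dispersion `disp_α(p)` as an extended natural number
(`0` by convention for the empty set, which is excluded by the hypotheses below). -/
def dispVal (α : Cbar C) (p : Polynomial (Cbar C)) : ℕ∞ :=
  sSup ((fun k : ℕ => (k : ℕ∞)) '' {k : ℕ | DispGe C α p k})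

/-- A polynomial is shift-free if it is coprime to each of its nontrivial shifts. -/
def ShiftFree {K : Type*} [Field K] [CharZero K] (p : Polynomial K) : Prop :=
  ∀ k : ℤ, k ≠ 0 → IsCoprime p (p.comp (X + Polynomial.C (k : K)))

/-- The data of the orbits `α_i + ℤ` of the roots of `ℓ₀ℓ_r`, with the minimal root
`minR i = α_{i,1}`, the maximal root `maxR i = α_{i,J_i}`, and the chosen bounds `β i`. -/
structure SuitableData (I : ℕ) where
  β : Fin I → Cbar C
  minR : Fin I → Cbar C
  maxR : Fin I → Cbar C
  minR_root : ∀ i, (Polynomial.aeval (minR i)) (ℓ 0 * ℓ r) = 0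
  maxR_root : ∀ i, (Polynomial.aeval (maxR i)) (ℓ 0 * ℓ r) = 0
  minR_le_maxR : ∀ i, ∃ m : ℕ, maxR i = minR i + (m : Cbar C)
  maxR_le_β : ∀ i, ∃ m : ℕ, β i = maxR i + (m : Cbar C)
  roots_between : ∀ i (m : ℤ), (Polynomial.aeval (minR i + (m : Cbar C))) (ℓ 0 * ℓ r) = 0 →
    0 ≤ m ∧ ∃ k : ℕ, maxR i = minR i + (m : Cbar C) + (k : Cbar C)
  orbits_distinct : ∀ i i', i ≠ i' → ∀ m : ℤ, β i ≠ β i' + (m : Cbar C)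
  orbits_cover : ∀ ξ : Cbar C, (Polynomial.aeval ξ) (ℓ 0 * ℓ r) = 0 →
    ∃ i, ∃ m : ℤ, ξ = β i + (m : Cbar C)
  conj_compat : ∀ (φ : Cbar C ≃ₐ[C] Cbar C) (i i' : Fin I), φ (maxR i) = maxR i' →
    β i - maxR i = β i' - maxR i'

/-- Membership in `Z = ⋃ᵢ {γ ∈ αᵢ + ℤ : α_{i,1} < γ ≤ βᵢ}`. -/
def memZ {I : ℕ} (D : SuitableData C ℓ r I) (γ : Cbar C) : Prop :=
  ∃ i, (∃ m : ℕ, γ + (m : Cbar C) = D.β i) ∧ (∃ k : ℕ, 1 ≤ k ∧ γ = D.minR i + (k : Cbar C))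

/-- `W` is a suitable basis of `A` at `{β₁, …, β_I}`. -/
def IsSuitableBasis {I : ℕ} (D : SuitableData C ℓ r I) (W : Fin r → (Fin r → RatFunc C)) :
    Prop :=
  IsVSBasis C r W ∧
    (∀ γ : Cbar C, memZ C ℓ r D γ → IsLocalIntegralBasis C ℓ r γ W) ∧
    (∀ γ : Cbar C, ¬ memZ C ℓ r D γ → localSpan C r γ W = localSpan C r γ (stdBasis C r))

set_option linter.unusedSectionVars false

section Valuation

variable {C : Type*} [Field C] [CharZero C]

lemma nuq_zero : nuq C 0 = ⊤ := by simp [nuq]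

lemma nuq_of_ne_zero {a : LS C} (ha : a ≠ 0) : nuq C a = (((a.order : ℤ) : ℝ) : EReal) := by
  simp [nuq, ha]

lemma nuq_ne_bot (a : LS C) : nuq C a ≠ ⊥ := by
  by_cases ha : a = 0
  · simp [ha, nuq_zero]
  · rw [nuq_of_ne_zero ha]; exact EReal.coe_ne_bot _

lemma le_nuq_add {x : EReal} {a b : LS C} (ha : x ≤ nuq C a) (hb : x ≤ nuq C b) :
    x ≤ nuq C (a + b) := by
  by_cases h : a + b = 0
  · simp [h, nuq_zero]
  by_cases ha0 : a = 0
  · simpa [ha0] using hb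
  by_cases hb0 : b = 0
  · simpa [hb0] using ha
  rw [nuq_of_ne_zero ha0] at ha
  rw [nuq_of_ne_zero hb0] at hb
  rw [nuq_of_ne_zero h]
  rcases min_le_iff.mp (HahnSeries.min_order_le_order_add h) with h' | h'
  · exact ha.trans (by exact_mod_cast h')
  · exact hb.trans (by exact_mod_cast h')

lemma le_nuq_sum {ι : Type*} (s : Finset ι) {x : EReal} {a : ι → LS C}
    (h : ∀ i ∈ s, x ≤ nuq C (a i)) : x ≤ nuq C (∑ i ∈ s, a i) :=
  Finset.sum_induction a (fun y => x ≤ nuq C y) (fun _ _ => le_nuq_add)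
    (by simp [nuq_zero]) h

lemma nuq_mul {a b : LS C} (ha : a ≠ 0) (hb : b ≠ 0) :
    nuq C (a * b) = nuq C a + nuq C b := by
  rw [nuq_of_ne_zero ha, nuq_of_ne_zero hb, nuq_of_ne_zero (mul_ne_zero ha hb),
    HahnSeries.order_mul ha hb]
  push_cast
  rfl

lemma le_nuq_mul {x : EReal} {a b : LS C} (ha : 0 ≤ nuq C a) (hb : x ≤ nuq C b) :
    x ≤ nuq C (a * b) := by
  by_cases ha0 : a = 0
  · simp [ha0, nuq_zero]
  by_cases hb0 : b = 0
  · simp [hb0, nuq_zero]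
  rw [nuq_mul ha0 hb0]
  simpa using add_le_add ha hb

lemma nuq_one : nuq C 1 = 0 := by
  rw [nuq_of_ne_zero one_ne_zero]; simp

lemma nuq_neg (a : LS C) : nuq C (-a) = nuq C a := by
  by_cases ha : a = 0
  · simp [ha]
  · rw [nuq_of_ne_zero ha, nuq_of_ne_zero (neg_ne_zero.mpr ha), HahnSeries.order_neg]

lemma nuq_inv_eq_zero {a : LS C} (h : nuq C a = 0) : nuq C a⁻¹ = 0 := by
  have ha : a ≠ 0 := by rintro rfl; simp [nuq_zero] at h
  have := nuq_mul ha (inv_ne_zero ha)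
  rw [mul_inv_cancel₀ ha, nuq_one, h, zero_add] at this
  exact this.symm

lemma coeff_ofPowerSeries_neg (s : PowerSeries (Cbar C)) {n : ℤ} (hn : n < 0) :
    (HahnSeries.ofPowerSeries ℤ (Cbar C) s).coeff n = 0 := by
  rw [PowerSeries.coeff_coe, if_pos hn]

lemma nuq_ofPowerSeries_nonneg (s : PowerSeries (Cbar C)) :
    0 ≤ nuq C (HahnSeries.ofPowerSeries ℤ (Cbar C) s) := by
  by_cases h : HahnSeries.ofPowerSeries ℤ (Cbar C) s = 0
  · simp [h, nuq_zero]
  rw [nuq_of_ne_zero h]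
  by_contra! hlt
  have hlt' : (HahnSeries.ofPowerSeries ℤ (Cbar C) s).order < 0 := by exact_mod_cast hlt
  exact HahnSeries.coeff_order_eq_zero.not.mpr h (coeff_ofPowerSeries_neg s hlt')

lemma coeff_zero_ofPowerSeries (s : PowerSeries (Cbar C)) :
    (HahnSeries.ofPowerSeries ℤ (Cbar C) s).coeff 0 = PowerSeries.constantCoeff s := by
  rw [PowerSeries.coeff_coe]; simp

lemma nuq_ofPowerSeries_eq_zero {s : PowerSeries (Cbar C)}
    (hs : PowerSeries.constantCoeff s ≠ 0) :
    nuq C (HahnSeries.ofPowerSeries ℤ (Cbar C) s) = 0 := by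
  refine le_antisymm ?_ (nuq_ofPowerSeries_nonneg s)
  rw [← coeff_zero_ofPowerSeries] at hs
  have h : HahnSeries.ofPowerSeries ℤ (Cbar C) s ≠ 0 := by
    intro h; simp [h] at hs
  rw [nuq_of_ne_zero h]
  exact_mod_cast HahnSeries.order_le_of_coeff_ne_zero hs

lemma nuq_ofPowerSeries_pos {s : PowerSeries (Cbar C)}
    (hs : PowerSeries.constantCoeff s = 0) :
    0 < nuq C (HahnSeries.ofPowerSeries ℤ (Cbar C) s) := by
  refine lt_of_le_of_ne (nuq_ofPowerSeries_nonneg s) fun h => ?_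
  have hne : HahnSeries.ofPowerSeries ℤ (Cbar C) s ≠ 0 := by
    intro h0; simp [h0, nuq_zero] at h
  rw [nuq_of_ne_zero hne] at h
  have ho : (HahnSeries.ofPowerSeries ℤ (Cbar C) s).order = 0 := by exact_mod_cast h.symm
  apply HahnSeries.coeff_order_eq_zero.not.mpr hne
  rw [ho, coeff_zero_ofPowerSeries, hs]

/-- The Taylor expansion of a polynomial at `c`, as a power series in `q`. -/
def taylorSeries (c : Cbar C) (p : Polynomial C) : PowerSeries (Cbar C) :=
  (((p.map (algebraMap C (Cbar C))).comp (X + Polynomial.C c) : Polynomial (Cbar C)) :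
    PowerSeries (Cbar C))

lemma constantCoeff_taylorSeries (c : Cbar C) (p : Polynomial C) :
    PowerSeries.constantCoeff (taylorSeries c p) = Polynomial.aeval c p := by
  rw [taylorSeries, Polynomial.constantCoeff_coe, Polynomial.coeff_zero_eq_eval_zero]
  simp [Polynomial.eval_comp, Polynomial.aeval_def, Polynomial.eval_map]

lemma taylorSeries_ne_zero (c : Cbar C) {p : Polynomial C} (hp : p ≠ 0) :
    taylorSeries c p ≠ 0 := by
  rw [taylorSeries, Ne, Polynomial.coe_eq_zero_iff]
  intro h
  rw [Polynomial.comp_eq_zero_iff] at h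
  rcases h with h | ⟨-, h⟩
  · exact hp ((Polynomial.map_eq_zero _).mp h)
  · have := congrArg (fun p => Polynomial.coeff p 1) h
    simp [Polynomial.coeff_C] at this

lemma algebraMap_laurentSeries (x : Cbar C) : algebraMap (Cbar C) (LS C) x = HahnSeries.C x := by
  rw [HahnSeries.algebraMap_apply']; simp

lemma evalAt_point (α : Cbar C) (m : ℤ) :
    algebraMap (Cbar C) (LS C) α + (m : LS C) + qv C =
      HahnSeries.ofPowerSeries ℤ (Cbar C)
        (PowerSeries.C (α + (m : Cbar C)) + PowerSeries.X) := by
  rw [map_add, HahnSeries.ofPowerSeries_C, HahnSeries.ofPowerSeries_X, map_add, map_intCast,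
    algebraMap_laurentSeries]
  rfl

lemma eval₂_point (α : Cbar C) (m : ℤ) (p : Polynomial C) :
    Polynomial.eval₂ ((algebraMap (Cbar C) (LS C)).comp (algebraMap C (Cbar C)))
      (algebraMap (Cbar C) (LS C) α + (m : LS C) + qv C) p =
      HahnSeries.ofPowerSeries ℤ (Cbar C) (taylorSeries (α + (m : Cbar C)) p) := by
  rw [evalAt_point]
  induction p using Polynomial.induction_on' with
  | add p q hp hq =>
    rw [Polynomial.eval₂_add, hp, hq]
    simp [taylorSeries]
  | monomial n a =>
    rw [Polynomial.eval₂_monomial, taylorSeries]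
    simp only [Polynomial.map_monomial, Polynomial.monomial_comp, Polynomial.coe_mul,
      Polynomial.coe_pow, Polynomial.coe_add, Polynomial.coe_X, Polynomial.coe_C, map_mul, map_pow,
      HahnSeries.ofPowerSeries_C, RingHom.comp_apply]
    rw [add_comm PowerSeries.X, algebraMap_laurentSeries]

lemma evalAt_toRat (α : Cbar C) (m : ℤ) (p : Polynomial C) :
    evalAt C α m (toRat C p) =
      HahnSeries.ofPowerSeries ℤ (Cbar C) (taylorSeries (α + (m : Cbar C)) p) := by
  rw [← eval₂_point, evalAt, RatFunc.eval_algebraMap]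
  rfl

lemma eval₂_point_ne_zero (α : Cbar C) (m : ℤ) {p : Polynomial C} (hp : p ≠ 0) :
    Polynomial.eval₂ ((algebraMap (Cbar C) (LS C)).comp (algebraMap C (Cbar C)))
      (algebraMap (Cbar C) (LS C) α + (m : LS C) + qv C) p ≠ 0 := by
  rw [eval₂_point]
  exact (map_ne_zero_iff _ HahnSeries.ofPowerSeries_injective).mpr (taylorSeries_ne_zero _ hp)

/-- Evaluation at `α + m + q` is a ring homomorphism. -/
def evalHom (α : Cbar C) (m : ℤ) : RatFunc C →+* LS C where
  toFun := evalAt C α m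
  map_one' := RatFunc.eval_one _ _
  map_zero' := RatFunc.eval_zero _ _
  map_add' x y := RatFunc.eval_add _ _ (eval₂_point_ne_zero α m x.denom_ne_zero)
    (eval₂_point_ne_zero α m y.denom_ne_zero)
  map_mul' x y := RatFunc.eval_mul _ _ (eval₂_point_ne_zero α m x.denom_ne_zero)
    (eval₂_point_ne_zero α m y.denom_ne_zero)

lemma evalHom_apply (α : Cbar C) (m : ℤ) (x : RatFunc C) : evalHom α m x = evalAt C α m x := rfl

lemma toRat_ne_zero {p : Polynomial C} (hp : p ≠ 0) : toRat C p ≠ 0 :=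
  RatFunc.algebraMap_ne_zero hp

lemma evalHom_toRat_ne_zero (α : Cbar C) (m : ℤ) {p : Polynomial C} (hp : p ≠ 0) :
    evalHom α m (toRat C p) ≠ 0 :=
  (_root_.map_ne_zero _).mpr (toRat_ne_zero hp)

lemma nuq_evalHom_toRat_nonneg (α : Cbar C) (m : ℤ) (p : Polynomial C) :
    0 ≤ nuq C (evalHom α m (toRat C p)) := by
  rw [evalHom_apply, evalAt_toRat]; exact nuq_ofPowerSeries_nonneg _

lemma nuq_evalHom_toRat_eq_zero {α : Cbar C} {m : ℤ} {p : Polynomial C}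
    (h : Polynomial.aeval (α + (m : Cbar C)) p ≠ 0) :
    nuq C (evalHom α m (toRat C p)) = 0 := by
  rw [evalHom_apply, evalAt_toRat]
  exact nuq_ofPowerSeries_eq_zero (by rwa [constantCoeff_taylorSeries])

lemma nuq_evalHom_toRat_pos {α : Cbar C} {m : ℤ} {p : Polynomial C}
    (h : Polynomial.aeval (α + (m : Cbar C)) p = 0) :
    0 < nuq C (evalHom α m (toRat C p)) := by
  rw [evalHom_apply, evalAt_toRat]
  exact nuq_ofPowerSeries_pos (by rwa [constantCoeff_taylorSeries])

lemma evalAt_congr {α α' : Cbar C} {m m' : ℤ} (h : α + (m : Cbar C) = α' + (m' : Cbar C)) :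
    evalAt C α m = evalAt C α' m' := by
  funext p
  rw [evalAt, evalAt, evalAt_point, evalAt_point, h]

end Valuation

section LocalRing

variable {C : Type*} [Field C] [CharZero C]

lemma inLocalRing_toRat (α : Cbar C) (p : Polynomial C) : InLocalRing C α (toRat C p) :=
  ⟨p, 1, by simp, by simp⟩

lemma ne_zero_of_aeval_ne_zero {α : Cbar C} {p : Polynomial C} (h : Polynomial.aeval α p ≠ 0) :
    p ≠ 0 := by
  rintro rfl; simp at h

lemma InLocalRing.add {α : Cbar C} {x y : RatFunc C} (hx : InLocalRing C α x)
    (hy : InLocalRing C α y) : InLocalRing C α (x + y) := by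
  obtain ⟨p, q, hq, rfl⟩ := hx
  obtain ⟨p', q', hq', rfl⟩ := hy
  refine ⟨p * q' + q * p', q * q', by simpa using ⟨hq, hq'⟩, ?_⟩
  rw [div_add_div _ _ (toRat_ne_zero (ne_zero_of_aeval_ne_zero hq))
    (toRat_ne_zero (ne_zero_of_aeval_ne_zero hq'))]
  simp

lemma InLocalRing.mul {α : Cbar C} {x y : RatFunc C} (hx : InLocalRing C α x)
    (hy : InLocalRing C α y) : InLocalRing C α (x * y) := by
  obtain ⟨p, q, hq, rfl⟩ := hx
  obtain ⟨p', q', hq', rfl⟩ := hy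
  exact ⟨p * p', q * q', by simpa using ⟨hq, hq'⟩, by rw [div_mul_div_comm]; simp⟩

lemma InLocalRing.neg {α : Cbar C} {x : RatFunc C} (hx : InLocalRing C α x) :
    InLocalRing C α (-x) := by
  obtain ⟨p, q, hq, rfl⟩ := hx
  exact ⟨-p, q, hq, by simp [neg_div]⟩

lemma InLocalRing.sub {α : Cbar C} {x y : RatFunc C} (hx : InLocalRing C α x)
    (hy : InLocalRing C α y) : InLocalRing C α (x - y) := by
  rw [sub_eq_add_neg]; exact hx.add hy.neg

lemma inLocalRing_zero (α : Cbar C) : InLocalRing C α 0 := by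
  simpa using inLocalRing_toRat α 0

lemma inLocalRing_div {α : Cbar C} (p : Polynomial C) {q : Polynomial C}
    (hq : Polynomial.aeval α q ≠ 0) : InLocalRing C α (toRat C p / toRat C q) :=
  ⟨p, q, hq, rfl⟩

lemma InLocalRing.aeval_denom_ne_zero {α : Cbar C} {x : RatFunc C} (hx : InLocalRing C α x) :
    Polynomial.aeval α x.denom ≠ 0 := by
  obtain ⟨p, q, hq, rfl⟩ := hx
  obtain ⟨s, hs⟩ := RatFunc.denom_div_dvd p q
  intro h
  apply hq
  rw [hs, map_mul, h, zero_mul]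

lemma nuq_evalHom_nonneg_iff {α : Cbar C} {x : RatFunc C} :
    0 ≤ nuq C (evalHom α 0 x) ↔ InLocalRing C α x := by
  constructor
  · intro h
    refine ⟨x.num, x.denom, fun h0 => ?_, (RatFunc.num_div_denom x).symm⟩
    obtain ⟨a, b, hab⟩ := RatFunc.isCoprime_num_denom x
    have hn : Polynomial.aeval α x.num ≠ 0 := by
      intro h1
      have := congrArg (Polynomial.aeval α) hab
      simp [h0, h1] at this
    have h2 : toRat C x.num = x * toRat C x.denom := by
      exact (div_eq_iff (toRat_ne_zero x.denom_ne_zero)).mp (RatFunc.num_div_denom x)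
    have hx0 : x ≠ 0 := by
      rintro rfl; simp at hn
    have h3 := congrArg (fun y => nuq C (evalHom α 0 y)) h2
    simp only [map_mul] at h3
    rw [nuq_mul ((_root_.map_ne_zero _).mpr hx0) (evalHom_toRat_ne_zero α 0 x.denom_ne_zero),
      nuq_evalHom_toRat_eq_zero (by simpa using hn)] at h3
    have h4 : 0 < nuq C (evalHom α 0 (toRat C x.denom)) :=
      nuq_evalHom_toRat_pos (by simpa using h0)
    exact absurd (h3 ▸ le_add_of_nonneg_left h) h4.not_ge
  · rintro ⟨p, q, hq, rfl⟩
    rw [map_div₀, div_eq_mul_inv]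
    exact le_nuq_mul (nuq_evalHom_toRat_nonneg _ _ _)
      (nuq_inv_eq_zero (nuq_evalHom_toRat_eq_zero (by simpa using hq))).ge

end LocalRing

section Shift

variable {C : Type*} [Field C] [CharZero C]

lemma polyσ_apply (p : Polynomial C) : polyσ C p = p.comp (X + Polynomial.C 1) := rfl

lemma ratσ_toRat (p : Polynomial C) : ratσ C (toRat C p) = toRat C (polyσ C p) := by
  have := RatFunc.map_apply_div (polyσ C : Polynomial C →+* Polynomial C)
    (nonZeroDivisors_le_comap_nonZeroDivisors_of_injective _ (polyσ C).injective) p 1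
  simpa [ratσ, RatFunc.coe_mapRingHom_eq_coe_map] using this

lemma aeval_polyσ (α : Cbar C) (p : Polynomial C) :
    Polynomial.aeval α (polyσ C p) = Polynomial.aeval (α + 1) p := by
  rw [polyσ_apply, Polynomial.aeval_comp]; simp

lemma aeval_polyσ_symm (α : Cbar C) (p : Polynomial C) :
    Polynomial.aeval (α + 1) ((polyσ C).symm p) = Polynomial.aeval α p := by
  rw [← aeval_polyσ, RingEquiv.apply_symm_apply]

lemma polyσ_ne_zero {p : Polynomial C} (hp : p ≠ 0) : polyσ C p ≠ 0 :=
  (map_ne_zero_iff _ (polyσ C).injective).mpr hp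

lemma ratσ_surjective : Function.Surjective (ratσ C) := fun x => by
  refine ⟨toRat C ((polyσ C).symm x.num) / toRat C ((polyσ C).symm x.denom), ?_⟩
  rw [map_div₀, ratσ_toRat, ratσ_toRat, RingEquiv.apply_symm_apply, RingEquiv.apply_symm_apply]
  exact RatFunc.num_div_denom x

lemma inLocalRing_ratσ_iff {α : Cbar C} {x : RatFunc C} :
    InLocalRing C α (ratσ C x) ↔ InLocalRing C (α + 1) x := by
  constructor
  · rintro ⟨p, q, hq, h⟩
    refine ⟨(polyσ C).symm p, (polyσ C).symm q, by rwa [aeval_polyσ_symm], ?_⟩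
    apply (ratσ C).injective
    rw [h, map_div₀, ratσ_toRat, ratσ_toRat, RingEquiv.apply_symm_apply,
      RingEquiv.apply_symm_apply]
  · rintro ⟨p, q, hq, rfl⟩
    exact ⟨polyσ C p, polyσ C q, by rwa [aeval_polyσ], by rw [map_div₀, ratσ_toRat, ratσ_toRat]⟩

lemma taylorSeries_polyσ (c : Cbar C) (p : Polynomial C) :
    taylorSeries c (polyσ C p) = taylorSeries (c + 1) p := by
  rw [taylorSeries, taylorSeries, polyσ_apply, Polynomial.map_comp, Polynomial.comp_assoc]
  congr 2
  simp [add_assoc]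

lemma evalHom_ratσ (α : Cbar C) (n : ℤ) (x : RatFunc C) :
    evalHom α n (ratσ C x) = evalHom α (n + 1) x := by
  rw [← RatFunc.num_div_denom x]
  change evalHom α n (ratσ C (toRat C _ / toRat C _)) = evalHom α (n + 1) (toRat C _ / toRat C _)
  have h (p : Polynomial C) :
      evalHom α n (ratσ C (toRat C p)) = evalHom α (n + 1) (toRat C p) := by
    rw [ratσ_toRat, evalHom_apply, evalHom_apply, evalAt_toRat, evalAt_toRat, taylorSeries_polyσ]
    push_cast
    rw [add_assoc]
  rw [map_div₀, map_div₀, map_div₀, h, h]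

end Shift

section Integral

variable {C : Type*} [Field C] [CharZero C] {ℓ : ℕ → Polynomial C} {r : ℕ}

lemma elemApply_eq (α : Cbar C) (f : Fin r → RatFunc C) (b : ℤ → LS C) (n : ℤ) :
    elemApply C r α f b n = ∑ i : Fin r, evalHom α n (f i) * b (n + (i : ℤ)) := rfl

lemma mem_SolSet_iff {α : Cbar C} {b : ℤ → LS C} :
    b ∈ SolSet C ℓ r α ↔
      ∀ n : ℤ, ∑ i ∈ Finset.range (r + 1), evalHom α n (toRat C (ℓ i)) * b (n + i) = 0 := Iff.rfl

/-- The growth of a sequence towards the left. -/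
def leftVal (b : ℤ → LS C) : EReal :=
  Filter.liminf (fun n : ℕ => nuq C (b (-(n : ℤ)))) Filter.atTop

lemma esub_nonneg_iff {x y : EReal} (hx : x ≠ ⊥) : 0 ≤ esub x y ↔ y = ⊤ ∨ y ≤ x := by
  by_cases hy : y = ⊤
  · simp [esub, hy]
  · rw [esub, if_neg hy, EReal.sub_nonneg (Or.inr hy) (Or.inl hx)]
    simp [hy]

lemma integralAt_iff {α : Cbar C} {f : Fin r → RatFunc C} :
    IntegralAt C ℓ r α f ↔ ∀ b ∈ SolSet C ℓ r α,
      leftVal b = ⊤ ∨ leftVal b ≤ nuq C (elemApply C r α f b 0) := by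
  simp only [IntegralAt, valAt, le_iInf_iff]
  exact forall₂_congr fun b _ => esub_nonneg_iff (nuq_ne_bot _)

lemma integralAt_sum_smul {ι : Type*} [Fintype ι] {α : Cbar C} {c : ι → RatFunc C}
    {w : ι → Fin r → RatFunc C}
    (hc : ∀ i, InLocalRing C α (c i)) (hw : ∀ i, IntegralAt C ℓ r α (w i)) :
    IntegralAt C ℓ r α (∑ i, c i • w i) := by
  rw [integralAt_iff]
  intro b hb
  by_cases ht : leftVal b = ⊤
  · exact Or.inl ht
  right
  have : elemApply C r α (∑ i, c i • w i) b 0 =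
      ∑ i, evalHom α 0 (c i) * elemApply C r α (w i) b 0 := by
    simp only [elemApply_eq, Finset.sum_apply, Pi.smul_apply, smul_eq_mul, map_sum, map_mul,
      Finset.sum_mul, Finset.mul_sum]
    rw [Finset.sum_comm]
    simp only [mul_assoc]
  rw [this]
  exact le_nuq_sum _ fun i _ => le_nuq_mul (nuq_evalHom_nonneg_iff.mpr (hc i))
    (((integralAt_iff.mp (hw i)) b hb).resolve_left ht)

lemma evalHom_add_one (α : Cbar C) (n : ℤ) (x : RatFunc C) :
    evalHom (α + 1) n x = evalHom α (n + 1) x :=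
  congrFun (evalAt_congr (by push_cast; ring)) x

lemma shift_mem_SolSet_iff {α : Cbar C} {b : ℤ → LS C} :
    (fun n => b (n + 1)) ∈ SolSet C ℓ r (α + 1) ↔ b ∈ SolSet C ℓ r α := by
  simp only [mem_SolSet_iff, evalHom_add_one]
  constructor
  · intro h n
    have := h (n - 1)
    simp only [sub_add_cancel] at this
    convert this using 4
    ring
  · intro h n
    convert h (n + 1) using 4
    ring

lemma leftVal_shift (b : ℤ → LS C) : leftVal (fun n => b (n + 1)) = leftVal b := by
  unfold leftVal
  rw [← Filter.liminf_nat_add (fun n : ℕ => nuq C (b (-(n : ℤ) + 1))) 1]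
  congr 1
  funext n
  congr 2
  push_cast
  ring

variable [NeZero r]

lemma elemApply_Smap (hr : ℓ r ≠ 0) {α : Cbar C} {b : ℤ → LS C} (hb : b ∈ SolSet C ℓ r α)
    (f : Fin r → RatFunc C) (n : ℤ) :
    elemApply C r α (Smap C ℓ r f) b n = elemApply C r α f b (n + 1) := by
  obtain ⟨s, rfl⟩ : ∃ s, r = s + 1 := Nat.exists_eq_succ_of_ne_zero (NeZero.ne r)
  have hl := mem_SolSet_iff.mp hb n
  rw [Finset.sum_range_succ, Finset.sum_range] at hl
  have hne := evalHom_toRat_ne_zero α n hr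
  have hlast : lastIdx (s + 1) = Fin.last s := rfl
  simp only [elemApply_eq, Smap, map_sub, map_mul, map_div₀, evalHom_ratσ, hlast, sub_mul,
    Finset.sum_sub_distrib, apply_ite (evalHom α n), map_zero]
  have h1 : ∑ i : Fin (s + 1), evalHom α (n + 1) (f (Fin.last s)) *
      (evalHom α n (toRat C (ℓ i)) / evalHom α n (toRat C (ℓ (s + 1)))) * b (n + (i : ℤ)) =
      - (evalHom α (n + 1) (f (Fin.last s)) * b (n + ((s + 1 : ℕ) : ℤ))) := by
    have h2 : ∑ i : Fin (s + 1), evalHom α (n + 1) (f (Fin.last s)) *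
      (evalHom α n (toRat C (ℓ i)) / evalHom α n (toRat C (ℓ (s + 1)))) * b (n + (i : ℤ)) =
      evalHom α (n + 1) (f (Fin.last s)) / evalHom α n (toRat C (ℓ (s + 1))) *
       ∑ i : Fin (s + 1), evalHom α n (toRat C (ℓ i)) * b (n + (i : ℤ)) := by
      rw [Finset.mul_sum]
      refine Finset.sum_congr rfl fun i _ => ?_
      ring
    rw [h2, eq_neg_of_add_eq_zero_left hl]
    field_simp
  rw [h1, sub_neg_eq_add, Fin.sum_univ_succ, Fin.sum_univ_castSucc]
  congr 1
  · simp only [Fin.val_zero, if_true, zero_mul, zero_add]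
    refine Finset.sum_congr rfl fun i _ => ?_
    rw [if_neg (by simp)]
    congr 2
    simp
    ring
  · congr 2
    simp
    ring

lemma integralAt_Smap_iff (hr : ℓ r ≠ 0) {α : Cbar C} {f : Fin r → RatFunc C} :
    IntegralAt C ℓ r α (Smap C ℓ r f) ↔ IntegralAt C ℓ r (α + 1) f := by
  have key (b : ℤ → LS C) (hb : b ∈ SolSet C ℓ r α) :
      elemApply C r (α + 1) f (fun n => b (n + 1)) 0 =
        elemApply C r α (Smap C ℓ r f) b 0 := by
    rw [elemApply_Smap hr hb]
    simp only [elemApply_eq, evalHom_add_one]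
    refine Finset.sum_congr rfl fun i _ => ?_
    congr 2
    ring
  rw [integralAt_iff, integralAt_iff]
  constructor
  · intro h b hb
    have hb' : (fun n => b (n - 1)) ∈ SolSet C ℓ r α := by
      rw [← shift_mem_SolSet_iff]; simpa using hb
    have := h _ hb'
    rw [← key _ hb', ← leftVal_shift] at this
    simpa using this
  · intro h b hb
    have := h _ (shift_mem_SolSet_iff.mpr hb)
    rwa [key b hb, leftVal_shift] at this

end Integral

section Extension

variable {C : Type*} [Field C] [CharZero C] (ℓ : ℕ → Polynomial C) (r : ℕ)

/-- The solution of `L` at `α` with prescribed values `v 0, …, v (r-1)`. -/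
def extendSol (α : Cbar C) (v : ℤ → LS C) (n : ℤ) : LS C :=
  if _hn : 0 ≤ n then
    if _hr : n < r then v n
    else -(evalHom α (n - r) (toRat C (ℓ r)))⁻¹ *
      ∑ i : Fin r, evalHom α (n - r) (toRat C (ℓ i)) * extendSol α v (n - r + (i : ℕ))
  else -(evalHom α n (toRat C (ℓ 0)))⁻¹ *
    ∑ i : Fin r, evalHom α n (toRat C (ℓ (i + 1))) * extendSol α v (n + ((i : ℕ) + 1))
termination_by if 0 ≤ n then n.toNat else (r - n).toNat
decreasing_by
  all_goals
    have := i.isLt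
    split_ifs <;> omega

variable {ℓ r}

lemma extendSol_of_lt (α : Cbar C) (v : ℤ → LS C) {n : ℤ} (hn : 0 ≤ n) (hr : n < r) :
    extendSol ℓ r α v n = v n := by
  rw [extendSol, dif_pos hn, dif_pos hr]

lemma extendSol_of_neg (α : Cbar C) (v : ℤ → LS C) {n : ℤ} (hn : n < 0) :
    extendSol ℓ r α v n = -(evalHom α n (toRat C (ℓ 0)))⁻¹ *
      ∑ i : Fin r, evalHom α n (toRat C (ℓ (i + 1))) *
        extendSol ℓ r α v (n + ((i : ℕ) + 1)) := by
  rw [extendSol, dif_neg hn.not_ge]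

lemma extendSol_add (α : Cbar C) (v : ℤ → LS C) {n : ℤ} (hn : 0 ≤ n) :
    extendSol ℓ r α v (n + r) = -(evalHom α n (toRat C (ℓ r)))⁻¹ *
      ∑ i : Fin r, evalHom α n (toRat C (ℓ i)) * extendSol ℓ r α v (n + (i : ℕ)) := by
  rw [extendSol, dif_pos (by omega), dif_neg (by omega)]
  simp only [add_sub_cancel_right]

lemma extendSol_mem (h0 : ℓ 0 ≠ 0) (hr : ℓ r ≠ 0) (α : Cbar C) (v : ℤ → LS C) :
    extendSol ℓ r α v ∈ SolSet C ℓ r α := by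
  rw [mem_SolSet_iff]
  intro n
  rcases lt_or_ge n 0 with hn | hn
  · rw [Finset.sum_range_succ', Finset.sum_range]
    have := evalHom_toRat_ne_zero α n h0
    simp only [Nat.cast_zero, add_zero, Nat.cast_add, Nat.cast_one]
    rw [extendSol_of_neg α v hn]
    field_simp
    ring
  · rw [Finset.sum_range_succ, Finset.sum_range, extendSol_add α v hn]
    have := evalHom_toRat_ne_zero α n hr
    field_simp
    ring

lemma nuq_extendSol_nonneg {α : Cbar C} {v : ℤ → LS C}
    (h0 : ∀ n : ℤ, n < 0 → Polynomial.aeval (α + (n : Cbar C)) (ℓ 0) ≠ 0)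
    (hv : ∀ n, 0 ≤ nuq C (v n)) {n : ℤ} (hn : n < r) :
    0 ≤ nuq C (extendSol ℓ r α v n) := by
  have key : ∀ k : ℕ, ∀ n : ℤ, -(k : ℤ) ≤ n → n < r → 0 ≤ nuq C (extendSol ℓ r α v n) := by
    intro k
    induction k with
    | zero =>
      intro n hn hnr
      rw [extendSol_of_lt α v (by simpa using hn) hnr]
      exact hv n
    | succ k ih =>
      intro n hn hnr
      rcases lt_or_ge n (-(k : ℤ)) with h | h
      · rw [extendSol_of_neg α v (by omega)]
        refine le_nuq_mul ?_ (le_nuq_sum _ fun i _ =>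
          le_nuq_mul (nuq_evalHom_toRat_nonneg _ _ _) (ih _ (by omega) (by omega)))
        rw [nuq_neg, nuq_inv_eq_zero (nuq_evalHom_toRat_eq_zero (h0 n (by omega)))]
      · exact ih n h hnr
  exact key n.natAbs n (by omega) hn

lemma leftVal_le {α : Cbar C} {b : ℤ → LS C} (hb : b ∈ SolSet C ℓ r α)
    (hr : ∀ n : ℤ, n < 0 → Polynomial.aeval (α + (n : Cbar C)) (ℓ r) ≠ 0)
    {m : ℤ} (hm : m < r) : leftVal b ≤ nuq C (b m) := by
  refine le_of_forall_lt_imp_le_of_dense fun c hc => ?_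
  obtain ⟨N, hN⟩ := Filter.eventually_atTop.mp (Filter.eventually_lt_of_lt_liminf hc)
  have key : ∀ k : ℕ, ∀ m : ℤ, m ≤ -(N : ℤ) + k → m < r → c ≤ nuq C (b m) := by
    intro k
    induction k with
    | zero =>
      intro m hm _
      have := hN m.natAbs (by omega)
      rw [show -(m.natAbs : ℤ) = m by omega] at this
      exact this.le
    | succ k ih =>
      intro m hm hmr
      rcases lt_or_ge (-(N : ℤ) + k) m with h | h
      · have heq := mem_SolSet_iff.mp hb (m - r)
        rw [Finset.sum_range_succ, sub_add_cancel] at heq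
        have hne : evalHom α (m - r) (toRat C (ℓ r)) ≠ 0 := by
          intro h0
          have := nuq_evalHom_toRat_eq_zero (hr (m - r) (by omega))
          simp [h0, nuq_zero] at this
        have hbm : b m = -(evalHom α (m - r) (toRat C (ℓ r)))⁻¹ *
            ∑ i ∈ Finset.range r, evalHom α (m - r) (toRat C (ℓ i)) * b (m - r + i) := by
          rw [eq_neg_of_add_eq_zero_left heq]
          field_simp
        rw [hbm]
        refine le_nuq_mul ?_ (le_nuq_sum _ fun i hi => ?_)
        · rw [nuq_neg, nuq_inv_eq_zero (nuq_evalHom_toRat_eq_zero (hr _ (by omega)))]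
        · have := Finset.mem_range.mp hi
          exact le_nuq_mul (nuq_evalHom_toRat_nonneg _ _ _) (ih _ (by omega) (by omega))
      · exact ih m h hmr
  exact key (m + N).toNat m (by omega) hm

lemma integralAt_iff_of_left_regular {α : Cbar C}
    (h : ∀ n : ℤ, n < 0 → Polynomial.aeval (α + (n : Cbar C)) (ℓ 0 * ℓ r) ≠ 0)
    {f : Fin r → RatFunc C} :
    IntegralAt C ℓ r α f ↔ ∀ i, InLocalRing C α (f i) := by
  have h0 (n : ℤ) (hn : n < 0) : Polynomial.aeval (α + (n : Cbar C)) (ℓ 0) ≠ 0 := by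
    have := h n hn; rw [map_mul] at this; exact left_ne_zero_of_mul this
  have hr (n : ℤ) (hn : n < 0) : Polynomial.aeval (α + (n : Cbar C)) (ℓ r) ≠ 0 := by
    have := h n hn; rw [map_mul] at this; exact right_ne_zero_of_mul this
  rw [integralAt_iff]
  constructor
  · intro hf i
    let v : ℤ → LS C := fun n => if n = i then 1 else 0
    have hv (n : ℤ) : 0 ≤ nuq C (v n) := by
      by_cases hn : n = i <;> simp [v, hn, nuq_one, nuq_zero]
    have hmem := extendSol_mem (ne_zero_of_aeval_ne_zero (h0 (-1) (by simp)))
      (ne_zero_of_aeval_ne_zero (hr (-1) (by simp))) α v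
    have hval (j : Fin r) : extendSol ℓ r α v (j : ℕ) = if j = i then 1 else 0 := by
      rw [extendSol_of_lt α v (by omega) (by exact_mod_cast j.isLt)]
      simp [v, Fin.ext_iff]
    have hle := leftVal_le hmem hr (m := (i : ℕ)) (by exact_mod_cast i.isLt)
    rw [hval, if_pos rfl, nuq_one] at hle
    have hge : 0 ≤ leftVal (extendSol ℓ r α v) :=
      Filter.le_liminf_of_le (by isBoundedDefault) (Filter.Eventually.of_forall fun n =>
        nuq_extendSol_nonneg h0 hv (by have := i.isLt; omega))
    have happ : elemApply C r α f (extendSol ℓ r α v) 0 = evalHom α 0 (f i) := by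
      simp [elemApply_eq, hval]
    rw [← nuq_evalHom_nonneg_iff, ← happ]
    rcases hf _ hmem with h' | h'
    · rw [h'] at hle; simp at hle
    · exact hge.trans h'
  · intro hf b hb
    right
    refine le_nuq_sum _ fun i _ => le_nuq_mul (nuq_evalHom_nonneg_iff.mpr (hf i)) ?_
    exact leftVal_le hb hr (by simp)

end Extension

section Lattice

variable {C : Type*} [Field C] [CharZero C] {ℓ : ℕ → Polynomial C} {r : ℕ}

lemma mem_localSpan_stdBasis_iff {γ : Cbar C} {f : Fin r → RatFunc C} :
    f ∈ localSpan C r γ (stdBasis C r) ↔ ∀ i, InLocalRing C γ (f i) := by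
  have key (c : Fin r → RatFunc C) : ∑ i, c i • stdBasis C r i = c := by
    funext j
    simp [Finset.sum_apply, stdBasis]
  simp only [localSpan, key]
  exact ⟨by rintro ⟨c, hc, rfl⟩; exact hc, fun h => ⟨f, h, rfl⟩⟩

lemma IsLocalIntegralBasis.mem_localSpan_iff {γ : Cbar C} {W : Fin r → Fin r → RatFunc C}
    (h : IsLocalIntegralBasis C ℓ r γ W) {f : Fin r → RatFunc C} :
    f ∈ localSpan C r γ W ↔ IntegralAt C ℓ r γ f := by
  refine ⟨?_, h.2.2 f⟩
  rintro ⟨c, hc, rfl⟩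
  exact integralAt_sum_smul hc h.2.1

variable [NeZero r]

lemma Smap_add (u v : Fin r → RatFunc C) :
    Smap C ℓ r (u + v) = Smap C ℓ r u + Smap C ℓ r v := by
  funext j
  simp only [Smap, Pi.add_apply, map_add]
  split_ifs <;> ring

lemma Smap_smul (c : RatFunc C) (v : Fin r → RatFunc C) :
    Smap C ℓ r (c • v) = ratσ C c • Smap C ℓ r v := by
  funext j
  simp only [Smap, Pi.smul_apply, smul_eq_mul, map_mul]
  split_ifs <;> ring

/-- `Smap` as an additive homomorphism. -/
def SmapHom (ℓ : ℕ → Polynomial C) (r : ℕ) [NeZero r] :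
    (Fin r → RatFunc C) →+ (Fin r → RatFunc C) :=
  AddMonoidHom.mk' (Smap C ℓ r) Smap_add

lemma Smap_sum {ι : Type*} (s : Finset ι) (v : ι → Fin r → RatFunc C) :
    Smap C ℓ r (∑ i ∈ s, v i) = ∑ i ∈ s, Smap C ℓ r (v i) :=
  map_sum (SmapHom ℓ r) v s

lemma Smap_surjective (h0 : ℓ 0 ≠ 0) (hr : ℓ r ≠ 0) : Function.Surjective (Smap C ℓ r) := by
  obtain ⟨s, rfl⟩ : ∃ s, r = s + 1 := Nat.exists_eq_succ_of_ne_zero (NeZero.ne r)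
  have hlast : lastIdx (s + 1) = Fin.last s := rfl
  have h0' := toRat_ne_zero h0
  have hr' := toRat_ne_zero hr
  intro v
  choose τ hτ using ratσ_surjective (C := C)
  let u : Fin (s + 1) → RatFunc C := Fin.snoc (α := fun _ => RatFunc C)
    (fun j : Fin s => τ (v j.succ - v 0 * (toRat C (ℓ (j + 1)) / toRat C (ℓ 0))))
    (τ (-v 0 * toRat C (ℓ (s + 1)) / toRat C (ℓ 0)))
  refine ⟨u, ?_⟩
  have hu : u (Fin.last s) = τ (-v 0 * toRat C (ℓ (s + 1)) / toRat C (ℓ 0)) := by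
    simp [u]
  funext j
  simp only [Smap, hlast, hu, hτ]
  refine Fin.cases ?_ (fun i => ?_) j
  · simp only [Fin.val_zero, if_true]
    field_simp
    ring
  · have hi : (⟨(i.succ : ℕ) - 1, lt_of_le_of_lt (Nat.sub_le _ _) i.succ.isLt⟩ : Fin (s + 1)) =
        i.castSucc := by
      ext; simp
    have hui : u i.castSucc =
        τ (v i.succ - v 0 * (toRat C (ℓ (i + 1)) / toRat C (ℓ 0))) := by
      simp [u]
    rw [if_neg (by simp), hi, hui, hτ, Fin.val_succ]
    field_simp
    ring

lemma inLocalRing_Smap_iff {γ : Cbar C}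
    (h0 : Polynomial.aeval γ (ℓ 0) ≠ 0) (hr : Polynomial.aeval γ (ℓ r) ≠ 0)
    {u : Fin r → RatFunc C} :
    (∀ i, InLocalRing C γ (Smap C ℓ r u i)) ↔ ∀ i, InLocalRing C (γ + 1) (u i) := by
  simp only [← inLocalRing_ratσ_iff]
  constructor
  · intro h
    have h0' := toRat_ne_zero (ne_zero_of_aeval_ne_zero h0)
    have hr' := toRat_ne_zero (ne_zero_of_aeval_ne_zero hr)
    have hlast : InLocalRing C γ (ratσ C (u (lastIdx r))) := by
      have hS : Smap C ℓ r u 0 =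
          -(ratσ C (u (lastIdx r)) * (toRat C (ℓ 0) / toRat C (ℓ r))) := by
        simp [Smap]
      have heq : ratσ C (u (lastIdx r)) =
          -(Smap C ℓ r u 0 * (toRat C (ℓ r) / toRat C (ℓ 0))) := by
        rw [hS]; field_simp
      rw [heq]
      exact ((h 0).mul (inLocalRing_div _ h0)).neg
    intro i
    by_cases hi : (i : ℕ) + 1 < r
    · have hS : ratσ C (u i) = Smap C ℓ r u ⟨i + 1, hi⟩ +
          ratσ C (u (lastIdx r)) * (toRat C (ℓ (i + 1)) / toRat C (ℓ r)) := by
        simp [Smap]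
      rw [hS]
      exact (h _).add (hlast.mul (inLocalRing_div _ hr))
    · have : i = lastIdx r := by
        ext
        have := i.isLt
        simp only [lastIdx]
        omega
      rwa [this]
  · intro h j
    refine InLocalRing.sub ?_ ((h _).mul (inLocalRing_div _ hr))
    split_ifs
    · exact inLocalRing_zero γ
    · exact h _

lemma SuitableData.eq_of_add_int {I : ℕ} (D : SuitableData C ℓ r I) {i i' : Fin I} {m : ℤ}
    (h : D.β i = D.β i' + (m : Cbar C)) : i = i' := by
  by_contra hne
  exact D.orbits_distinct i i' hne m h

lemma SuitableData.minR_left_regular {I : ℕ} (D : SuitableData C ℓ r I) (i : Fin I) (n : ℤ)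
    (hn : n < 0) : Polynomial.aeval (D.minR i + (n : Cbar C)) (ℓ 0 * ℓ r) ≠ 0 := by
  intro h
  exact absurd (D.roots_between i n h).1 (by omega)

lemma SuitableData.not_memZ_minR {I : ℕ} (D : SuitableData C ℓ r I) (i : Fin I) :
    ¬ memZ C ℓ r D (D.minR i) := by
  rintro ⟨i', ⟨m, hm⟩, k, hk, hk'⟩
  obtain ⟨a, ha⟩ := D.minR_le_maxR i
  obtain ⟨b, hb⟩ := D.maxR_le_β i
  have : i = i' := D.eq_of_add_int (m := (a : ℤ) + b - m) (by
    rw [hb, ha, ← hm]; push_cast; ring)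
  subst this
  have : (k : Cbar C) = 0 := by linear_combination -hk'
  have : k = 0 := by exact_mod_cast this
  omega

lemma SuitableData.aeval_ne_zero {I : ℕ} (D : SuitableData C ℓ r I) {γ : Cbar C}
    (hβ : ∀ i, γ ≠ D.β i) (hZ : ¬ memZ C ℓ r D (γ + 1)) :
    Polynomial.aeval γ (ℓ 0 * ℓ r) ≠ 0 := by
  intro h
  obtain ⟨i, m, hm⟩ := D.orbits_cover γ h
  obtain ⟨a, ha⟩ := D.minR_le_maxR i
  obtain ⟨b, hb⟩ := D.maxR_le_β i
  have hγ : γ = D.minR i + ((a + b + m : ℤ) : Cbar C) := by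
    rw [hm, hb, ha]; push_cast; ring
  obtain ⟨hpos, k, hk⟩ := D.roots_between i (a + b + m) (hγ ▸ h)
  rw [← hγ] at hk
  obtain ⟨t, ht⟩ := Int.eq_ofNat_of_zero_le hpos
  rcases Nat.eq_zero_or_pos (k + b) with h0 | h0
  · apply hβ i
    have hk0 : k = 0 := by omega
    have hb0 : b = 0 := by omega
    simp [hb, hk, hk0, hb0]
  · apply hZ
    refine ⟨i, ⟨k + b - 1, ?_⟩, t + 1, by omega, ?_⟩
    · rw [hb, hk, Nat.cast_sub h0]; push_cast; ring
    · rw [hγ, ht]; push_cast; ring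

/-- Away from the bounds `β`, the shift maps the local lattice at `γ + 1` onto that at `γ`. -/
lemma IsSuitableBasis.Smap_mem_localSpan_iff {I : ℕ} {D : SuitableData C ℓ r I}
    {W : Fin r → Fin r → RatFunc C} (hW : IsSuitableBasis C ℓ r D W) (hr : ℓ r ≠ 0)
    {γ : Cbar C} (hβ : ∀ i, γ ≠ D.β i) {u : Fin r → RatFunc C} :
    Smap C ℓ r u ∈ localSpan C r γ W ↔ u ∈ localSpan C r (γ + 1) W := by
  by_cases hZ1 : memZ C ℓ r D (γ + 1)
  · rw [(hW.2.1 _ hZ1).mem_localSpan_iff, ← integralAt_Smap_iff hr]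
    obtain ⟨i, ⟨m, hm⟩, k, hk, hk'⟩ := hZ1
    rcases Nat.eq_or_lt_of_le hk with h1 | h1
    · obtain rfl : γ = D.minR i := by
        rw [← h1] at hk'; push_cast at hk'; exact add_right_cancel hk'
      rw [hW.2.2 _ (D.not_memZ_minR i), mem_localSpan_stdBasis_iff,
        integralAt_iff_of_left_regular (D.minR_left_regular i)]
    · have hZ : memZ C ℓ r D γ := by
        refine ⟨i, ⟨m + 1, ?_⟩, k - 1, by omega, ?_⟩
        · rw [← hm]; push_cast; ring
        · rw [Nat.cast_sub hk]; push_cast; linear_combination hk'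
      rw [(hW.2.1 _ hZ).mem_localSpan_iff]
  · have hZ : ¬ memZ C ℓ r D γ := by
      rintro ⟨i, ⟨m, hm⟩, k, hk, hk'⟩
      rcases Nat.eq_zero_or_pos m with h0 | h0
      · apply hβ i
        simpa [h0] using hm
      · apply hZ1
        refine ⟨i, ⟨m - 1, ?_⟩, k + 1, by omega, ?_⟩
        · rw [← hm, Nat.cast_sub h0]; push_cast; ring
        · rw [hk']; push_cast; ring
    have hne := D.aeval_ne_zero hβ hZ1
    rw [map_mul] at hne
    rw [hW.2.2 _ hZ, hW.2.2 _ hZ1, mem_localSpan_stdBasis_iff, mem_localSpan_stdBasis_iff,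
      inLocalRing_Smap_iff (left_ne_zero_of_mul hne) (right_ne_zero_of_mul hne)]

lemma mem_localSpan_sum_iff {W : Fin r → Fin r → RatFunc C}
    (hW : LinearIndependent (RatFunc C) W) {γ : Cbar C} {c : Fin r → RatFunc C} :
    ∑ i, c i • W i ∈ localSpan C r γ W ↔ ∀ i, InLocalRing C γ (c i) := by
  refine ⟨?_, fun h => ⟨c, h, rfl⟩⟩
  rintro ⟨c', hc', h⟩
  rw [← sub_eq_zero, ← Finset.sum_sub_distrib] at h
  simp only [← sub_smul] at h
  intro i
  rw [sub_eq_zero.mp (Fintype.linearIndependent_iff.mp hW _ h i)]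
  exact hc' i

lemma basis_mem_localSpan (W : Fin r → Fin r → RatFunc C) (γ : Cbar C) (i : Fin r) :
    W i ∈ localSpan C r γ W := by
  refine ⟨fun j => if j = i then 1 else 0, fun j => ?_, by simp⟩
  dsimp only
  split_ifs
  · simpa using inLocalRing_toRat γ 1
  · exact inLocalRing_zero γ

end Lattice

section Transversal

variable {C : Type*} [Field C] [CharZero C]

lemma isConjRoot_add_intCast {x y : Cbar C} (h : IsConjRoot C x y) (k : ℤ) :
    IsConjRoot C (x + (k : Cbar C)) (y + (k : Cbar C)) := by
  simpa using h.add_algebraMap (k : C)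

lemma eq_zero_of_isConjRoot_add_intCast {x : Cbar C} {k : ℤ}
    (h : IsConjRoot C x (x + (k : Cbar C))) : k = 0 := by
  by_contra hk
  have hconj : ∀ n : ℕ, IsConjRoot C x (x + ((n * k : ℤ) : Cbar C)) := by
    intro n
    induction n with
    | zero => simpa using IsConjRoot.refl
    | succ n ih =>
      refine h.trans ?_
      have := isConjRoot_add_intCast ih k
      convert this using 1
      push_cast
      ring
  have hne : minpoly C x ≠ 0 := minpoly.ne_zero (Algebra.IsIntegral.isIntegral x)
  have hsub : Set.range (fun n : ℕ => x + ((n * k : ℤ) : Cbar C)) ⊆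
      (minpoly C x).rootSet (Cbar C) := by
    rintro _ ⟨n, rfl⟩
    rw [Polynomial.mem_rootSet]
    exact ⟨hne, (hconj n).aeval_eq_zero⟩
  refine Set.infinite_range_of_injective ?_ (((minpoly C x).rootSet_finite (Cbar C)).subset hsub)
  intro n m hnm
  have h1 : (n : ℤ) * k = m * k := by exact_mod_cast add_left_cancel hnm
  exact_mod_cast mul_right_cancel₀ hk h1

/-- A Galois-stable set of representatives of the orbits of `ℤ` on the algebraic closure. -/
structure IsTransversal (T : Set (Cbar C)) : Prop where
  exists_add_mem : ∀ ξ, ∃ k : ℤ, ξ + (k : Cbar C) ∈ T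
  eq_zero : ∀ ξ (k : ℤ), ξ ∈ T → ξ + (k : Cbar C) ∈ T → k = 0
  conj_mem : ∀ ξ η, IsConjRoot C ξ η → ξ ∈ T → η ∈ T

/-- The equivalence relation generated by conjugation and integer translations. -/
def conjShiftSetoid (C : Type*) [Field C] [CharZero C] : Setoid (Cbar C) where
  r ξ η := ∃ k : ℤ, IsConjRoot C (ξ + (k : Cbar C)) η
  iseqv :=
    { refl := fun ξ => ⟨0, by simpa using IsConjRoot.refl⟩
      symm := by
        rintro ξ η ⟨k, h⟩
        refine ⟨-k, ?_⟩
        simpa using (isConjRoot_add_intCast h (-k)).symm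
      trans := by
        rintro ξ η ζ ⟨k, h⟩ ⟨m, h'⟩
        refine ⟨k + m, ?_⟩
        have := (isConjRoot_add_intCast h m).trans h'
        simpa [add_assoc] using this }

lemma exists_isTransversal {ι : Type*} (β : ι → Cbar C)
    (hβ : ∀ i j (k : ℤ), IsConjRoot C (β i + (k : Cbar C)) (β j) → k = 0) :
    ∃ T : Set (Cbar C), IsTransversal T ∧ ∀ i, β i ∈ T := by
  classical
  let Q := Quotient (conjShiftSetoid C)
  let cls : Cbar C → Q := Quotient.mk _
  have hcls : ∀ ξ η, cls ξ = cls η ↔ ∃ k : ℤ, IsConjRoot C (ξ + (k : Cbar C)) η :=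
    fun ξ η => Quotient.eq (r := conjShiftSetoid C)
  have hex : ∀ q : Q, ∃ ξ, cls ξ = q ∧ ((∃ i, cls (β i) = q) → ∃ i, ξ = β i) := by
    intro q
    by_cases h : ∃ i, cls (β i) = q
    · obtain ⟨i, hi⟩ := h
      exact ⟨β i, hi, fun _ => ⟨i, rfl⟩⟩
    · obtain ⟨ξ, hξ⟩ := Quotient.exists_rep q
      exact ⟨ξ, hξ, fun h' => absurd h' h⟩
  choose s hs hsβ using hex
  have hshift : ∀ ξ (k : ℤ), cls (ξ + (k : Cbar C)) = cls ξ := by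
    intro ξ k
    rw [hcls]
    exact ⟨-k, by simpa using IsConjRoot.refl⟩
  refine ⟨{ξ | IsConjRoot C ξ (s (cls ξ))}, ⟨?_, ?_, ?_⟩, ?_⟩
  · intro ξ
    obtain ⟨k, hk⟩ := (hcls ξ _).mp (hs (cls ξ)).symm
    exact ⟨k, by rw [Set.mem_ofPred_eq, hshift]; exact hk⟩
  · intro ξ k h h'
    rw [Set.mem_ofPred_eq] at h h'
    rw [hshift] at h'
    exact eq_zero_of_isConjRoot_add_intCast (h.trans h'.symm)
  · intro ξ η h hξ
    have : cls ξ = cls η := (hcls _ _).mpr ⟨0, by simpa using h⟩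
    rw [Set.mem_ofPred_eq] at hξ ⊢
    rw [← this]
    exact h.symm.trans hξ
  · intro i
    obtain ⟨j, hj⟩ := hsβ (cls (β i)) ⟨i, rfl⟩
    obtain ⟨k, hk⟩ := (hcls _ _).mp (hs (cls (β i))).symm
    rw [hj] at hk
    obtain rfl := hβ _ _ _ hk
    rw [Set.mem_ofPred_eq, hj]
    simpa using hk

variable {ℓ : ℕ → Polynomial C} {r : ℕ}

lemma SuitableData.nonpos_of_root {I : ℕ} (D : SuitableData C ℓ r I) {i : Fin I} {s : ℤ}
    (h : Polynomial.aeval (D.maxR i + (s : Cbar C)) (ℓ 0 * ℓ r) = 0) : s ≤ 0 := by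
  obtain ⟨n, hn⟩ := D.minR_le_maxR i
  obtain ⟨-, k, hk⟩ := D.roots_between i (n + s) (by
    rw [← h, hn]
    push_cast
    rw [add_assoc])
  rw [hn] at hk
  push_cast at hk
  have : (n : ℤ) = n + s + k := by
    have h' : ((n : ℤ) : Cbar C) = ((n + s + k : ℤ) : Cbar C) := by
      push_cast
      linear_combination hk
    exact_mod_cast h'
  omega

lemma SuitableData.eq_zero_of_isConjRoot {I : ℕ} (D : SuitableData C ℓ r I) {i j : Fin I} {k : ℤ}
    (h : IsConjRoot C (D.β i + (k : Cbar C)) (D.β j)) : k = 0 := by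
  obtain ⟨φ, hφ⟩ := isConjRoot_iff_exists_algEquiv.mp h
  obtain ⟨n, hn⟩ := D.maxR_le_β i
  obtain ⟨m, hm⟩ := D.maxR_le_β j
  have hroot : ∀ (ψ : Cbar C ≃ₐ[C] Cbar C) (l : Fin I),
      Polynomial.aeval (ψ (D.maxR l)) (ℓ 0 * ℓ r) = 0 := fun ψ l => by
    rw [Polynomial.aeval_algHom_apply, D.maxR_root l, _root_.map_zero]
  have h1 : φ (D.maxR j) = D.maxR i + ((n + k - m : ℤ) : Cbar C) := by
    rw [hm, map_add, map_natCast, hn] at hφ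
    push_cast
    linear_combination hφ
  have h2 : φ.symm (D.maxR i) = D.maxR j + ((-(n + k - m) : ℤ) : Cbar C) := by
    rw [AlgEquiv.symm_apply_eq, map_add, h1, map_intCast]
    push_cast
    ring
  have h3 := D.nonpos_of_root (h1 ▸ hroot φ j)
  have h4 := D.nonpos_of_root (h2 ▸ hroot φ.symm i)
  have h5 : (n : ℤ) + k - m = 0 := by omega
  have h6 := D.conj_compat φ j i (by rw [h1, h5]; simp)
  rw [hn, hm, add_sub_cancel_left, add_sub_cancel_left] at h6
  have : m = n := by exact_mod_cast h6
  omega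

/-- Nonzero polynomials all of whose roots lie in `T`. -/
def RootsIn (T : Set (Cbar C)) (u : Polynomial C) : Prop :=
  u ≠ 0 ∧ ∀ ξ : Cbar C, Polynomial.aeval ξ u = 0 → ξ ∈ T

lemma rootsIn_one (T : Set (Cbar C)) : RootsIn T (1 : Polynomial C) :=
  ⟨one_ne_zero, fun ξ h => by simp at h⟩

lemma RootsIn.mul {T : Set (Cbar C)} {u v : Polynomial C} (hu : RootsIn T u) (hv : RootsIn T v) :
    RootsIn T (u * v) := by
  refine ⟨mul_ne_zero hu.1 hv.1, fun ξ h => ?_⟩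
  rw [map_mul] at h
  exact (mul_eq_zero.mp h).elim (hu.2 ξ) (hv.2 ξ)

lemma IsTransversal.shiftFree {T : Set (Cbar C)} (hT : IsTransversal T) {p : Polynomial (Cbar C)}
    (hp : ∀ ξ, p.eval ξ = 0 → ξ ∈ T) : ShiftFree p := by
  intro k hk
  rw [Polynomial.isCoprime_iff_aeval_ne_zero_of_isAlgClosed _ (Cbar C)]
  intro ξ
  by_contra! h
  simp only [Polynomial.coe_aeval_eq_eval, eval_comp, eval_add, eval_X, eval_C] at h
  exact hk (hT.eq_zero ξ k (hp _ h.1) (hp _ h.2))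

lemma IsTransversal.shiftFree_map_mul_prod {T : Set (Cbar C)} (hT : IsTransversal T) {I : ℕ}
    {β : Fin I → Cbar C} (hβ : ∀ i, β i ∈ T) {d : Polynomial C} (hd : RootsIn T d) :
    ShiftFree (d.map (algebraMap C (Cbar C)) * ∏ i, (X - Polynomial.C (β i))) := by
  refine hT.shiftFree fun ξ h => ?_
  rw [eval_mul, eval_map_algebraMap, eval_prod, mul_eq_zero, Finset.prod_eq_zero_iff] at h
  rcases h with h | ⟨i, -, h⟩
  · exact hd.2 ξ h
  · rw [eval_sub, eval_X, eval_C, sub_eq_zero] at h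
    exact h ▸ hβ i

end Transversal

section Reduction

variable {C : Type*} [Field C] [CharZero C] {ℓ : ℕ → Polynomial C} {r : ℕ}

lemma exists_eq_div_prod_denom {ι : Type*} [Fintype ι] (x : ι → RatFunc C) :
    ∃ p : ι → Polynomial C, ∀ i, x i = toRat C (p i) / toRat C (∏ j, (x j).denom) := by
  have h : ∀ i, ∃ p : Polynomial C, x i = toRat C p / toRat C (∏ j, (x j).denom) := by
    intro i
    obtain ⟨k, hk⟩ := Finset.dvd_prod_of_mem (fun j => (x j).denom) (Finset.mem_univ i)
    have hne : ∏ j, (x j).denom ≠ 0 := Finset.prod_ne_zero_iff.mpr fun j _ => (x j).denom_ne_zero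
    have hk0 : k ≠ 0 := by
      rintro rfl
      exact hne (by rw [hk, mul_zero])
    refine ⟨(x i).num * k, ?_⟩
    rw [hk, map_mul, map_mul, mul_div_mul_right _ _ (toRat_ne_zero hk0), RatFunc.num_div_denom]
  choose p hp using h
  exact ⟨p, hp⟩

variable [NeZero r]

lemma IsSuitableBasis.rootsIn {I : ℕ} {D : SuitableData C ℓ r I} {W : Fin r → Fin r → RatFunc C}
    (hW : IsSuitableBasis C ℓ r D W) (hr : ℓ r ≠ 0) {T : Set (Cbar C)} (hT : ∀ i, D.β i ∈ T)
    {e : Polynomial C} {M : Matrix (Fin r) (Fin r) (Polynomial C)} (he : e ≠ 0)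
    (hSW : ∀ i, Smap C ℓ r (W i) = ∑ j, (toRat C (M i j) / toRat C e) • W j)
    (hgcd : ∀ d : Polynomial C, d ∣ e → (∀ i j, d ∣ M i j) → IsUnit d) : RootsIn T e := by
  refine ⟨he, fun γ hγ => ?_⟩
  by_contra hγT
  have hβ : ∀ i, γ ≠ D.β i := fun i h => hγT (h ▸ hT i)
  have hM : ∀ i j, minpoly C γ ∣ M i j := by
    intro i j
    rw [minpoly.dvd_iff]
    have h1 := (hW.Smap_mem_localSpan_iff hr hβ).mpr (basis_mem_localSpan W (γ + 1) i)
    rw [hSW, mem_localSpan_sum_iff hW.1.1] at h1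
    obtain ⟨p, q, hq, hpq⟩ := h1 j
    rw [div_eq_div_iff (toRat_ne_zero he) (toRat_ne_zero (ne_zero_of_aeval_ne_zero hq)),
      ← map_mul, ← map_mul] at hpq
    have h2 := congrArg (Polynomial.aeval γ) (RatFunc.algebraMap_injective C hpq)
    rw [map_mul, map_mul, hγ, mul_zero] at h2
    exact (mul_eq_zero.mp h2).resolve_right hq
  exact minpoly.not_isUnit C γ (hgcd _ ((minpoly.dvd_iff).mpr hγ) hM)

lemma IsSuitableBasis.exists_inverse {I : ℕ} {D : SuitableData C ℓ r I}
    {W : Fin r → Fin r → RatFunc C} (hW : IsSuitableBasis C ℓ r D W) (h0 : ℓ 0 ≠ 0)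
    (hr : ℓ r ≠ 0) {T : Set (Cbar C)} (hT : ∀ i, D.β i ∈ T) :
    ∃ (w : Polynomial C) (N : Matrix (Fin r) (Fin r) (Polynomial C)), RootsIn T (polyσ C w) ∧
      ∀ i, Smap C ℓ r (∑ j, (toRat C (N i j) / toRat C w) • W j) = W i := by
  have hex : ∀ i, ∃ c : Fin r → RatFunc C, Smap C ℓ r (∑ j, c j • W j) = W i := by
    intro i
    obtain ⟨v, hv⟩ := Smap_surjective h0 hr (W i)
    have hmem : v ∈ Submodule.span (RatFunc C) (Set.range W) := hW.1.2 ▸ Submodule.mem_top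
    obtain ⟨c, hc⟩ := (Submodule.mem_span_range_iff_exists_fun _).mp hmem
    exact ⟨c, by rw [hc, hv]⟩
  choose c hc using hex
  obtain ⟨p, hp⟩ := exists_eq_div_prod_denom fun x : Fin r × Fin r => c x.1 x.2
  have hw : ∏ x : Fin r × Fin r, (c x.1 x.2).denom ≠ 0 :=
    Finset.prod_ne_zero_iff.mpr fun x _ => (c x.1 x.2).denom_ne_zero
  refine ⟨_, Matrix.of fun i j => p (i, j), ⟨polyσ_ne_zero hw, fun γ hγ => ?_⟩, fun i => ?_⟩
  · by_contra hγT
    have hβ : ∀ i, γ ≠ D.β i := fun i h => hγT (h ▸ hT i)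
    rw [aeval_polyσ, map_prod, Finset.prod_eq_zero_iff] at hγ
    obtain ⟨⟨i, j⟩, -, hij⟩ := hγ
    have h1 := basis_mem_localSpan W γ i
    rw [← hc, hW.Smap_mem_localSpan_iff hr hβ, mem_localSpan_sum_iff hW.1.1] at h1
    exact (h1 j).aeval_denom_ne_zero hij
  · rw [← hc i]
    congr 1
    exact Finset.sum_congr rfl fun j _ => by rw [Matrix.of_apply, ← hp (i, j)]

lemma Smap_eq_Dmap_add (v : Fin r → RatFunc C) : Smap C ℓ r v = Dmap C ℓ r v + v :=
  (sub_add_cancel _ _).symm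

lemma Dmap_add (u v : Fin r → RatFunc C) :
    Dmap C ℓ r (u + v) = Dmap C ℓ r u + Dmap C ℓ r v := by
  rw [Dmap, Smap_add, Dmap, Dmap]
  abel

lemma Dmap_neg (v : Fin r → RatFunc C) : Dmap C ℓ r (-v) = -Dmap C ℓ r v := by
  have h : Smap C ℓ r (-v) = -Smap C ℓ r v := (SmapHom (C := C) ℓ r).map_neg v
  rw [Dmap, h, Dmap]
  abel

/-- `v` is, modulo differences, a combination of the entries of `W` whose coefficients have a
common denominator with roots in `T`. -/
def ReducesTo (ℓ : ℕ → Polynomial C) (T : Set (Cbar C)) (W : Fin r → Fin r → RatFunc C)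
    (v : Fin r → RatFunc C) : Prop :=
  ∃ (g : Fin r → RatFunc C) (d : Polynomial C) (p : Fin r → Polynomial C), RootsIn T d ∧
    v = Dmap C ℓ r g + ∑ i, (toRat C (p i) / toRat C d) • W i

variable {T : Set (Cbar C)} {W : Fin r → Fin r → RatFunc C}

lemma ReducesTo.add {u v : Fin r → RatFunc C} (hu : ReducesTo ℓ T W u) (hv : ReducesTo ℓ T W v) :
    ReducesTo ℓ T W (u + v) := by
  obtain ⟨g, d, p, hd, rfl⟩ := hu
  obtain ⟨g', d', p', hd', rfl⟩ := hv
  refine ⟨g + g', d * d', fun i => p i * d' + d * p' i, hd.mul hd', ?_⟩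
  have h : ∀ i, toRat C (p i * d' + d * p' i) / toRat C (d * d') =
      toRat C (p i) / toRat C d + toRat C (p' i) / toRat C d' := fun i => by
    rw [div_add_div _ _ (toRat_ne_zero hd.1) (toRat_ne_zero hd'.1)]
    simp only [map_add, map_mul]
  simp only [h, add_smul, Finset.sum_add_distrib, Dmap_add]
  abel

lemma reducesTo_Dmap (g : Fin r → RatFunc C) : ReducesTo ℓ T W (Dmap C ℓ r g) :=
  ⟨g, 1, 0, rootsIn_one T, by simp⟩

lemma reducesTo_Smap_iff {v : Fin r → RatFunc C} :
    ReducesTo ℓ T W (Smap C ℓ r v) ↔ ReducesTo ℓ T W v := by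
  refine ⟨fun h => ?_, fun h => Smap_eq_Dmap_add (ℓ := ℓ) v ▸ (reducesTo_Dmap v).add h⟩
  have h' := h.add (reducesTo_Dmap (-v))
  rwa [Smap_eq_Dmap_add, Dmap_neg, add_neg_cancel_comm] at h'

/-- Every combination of the entries of `W` with denominator `u` can be reduced. -/
def DenomReduces (ℓ : ℕ → Polynomial C) (T : Set (Cbar C)) (W : Fin r → Fin r → RatFunc C)
    (u : Polynomial C) : Prop :=
  ∀ p : Fin r → Polynomial C, ReducesTo ℓ T W (∑ i, (toRat C (p i) / toRat C u) • W i)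

lemma RootsIn.denomReduces {u : Polynomial C} (hu : RootsIn T u) : DenomReduces ℓ T W u :=
  fun p => ⟨0, u, p, hu, by
    have h : Smap C ℓ r 0 = 0 := (SmapHom (C := C) ℓ r).map_zero
    rw [Dmap, h, sub_zero, zero_add]⟩

lemma DenomReduces.mul_of_isCoprime {u v : Polynomial C} (hu0 : u ≠ 0) (hv0 : v ≠ 0)
    (hu : DenomReduces ℓ T W u) (hv : DenomReduces ℓ T W v) (huv : IsCoprime u v) :
    DenomReduces ℓ T W (u * v) := by
  intro p
  obtain ⟨a, b, hab⟩ := huv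
  have h : ∀ i, toRat C (p i) / toRat C (u * v) =
      toRat C (p i * b) / toRat C u + toRat C (p i * a) / toRat C v := fun i => by
    rw [div_add_div _ _ (toRat_ne_zero hu0) (toRat_ne_zero hv0), ← map_mul, ← map_mul, ← map_mul,
      ← map_add]
    congr 2
    linear_combination -(p i) * hab
  simp only [h, add_smul, Finset.sum_add_distrib]
  exact (hu _).add (hv _)

lemma Smap_sum_div_smul {B : Matrix (Fin r) (Fin r) (Polynomial C)} {b : Polynomial C}
    {V : Fin r → Fin r → RatFunc C}
    (hV : ∀ i, Smap C ℓ r (V i) = ∑ j, (toRat C (B i j) / toRat C b) • W j)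
    (p : Fin r → Polynomial C) (u : Polynomial C) :
    Smap C ℓ r (∑ i, (toRat C (p i) / toRat C u) • V i) =
      ∑ j, (toRat C (∑ i, polyσ C (p i) * B i j) / toRat C (polyσ C u * b)) • W j := by
  simp only [Smap_sum, Smap_smul, hV, map_div₀, ratσ_toRat, Finset.smul_sum, smul_smul, map_sum,
    Finset.sum_div, Finset.sum_smul, map_mul]
  rw [Finset.sum_comm]
  exact Finset.sum_congr rfl fun j _ => Finset.sum_congr rfl fun i _ => by rw [div_mul_div_comm]

lemma DenomReduces.of_polyσ_mul {e : Polynomial C} {M : Matrix (Fin r) (Fin r) (Polynomial C)}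
    (hSW : ∀ i, Smap C ℓ r (W i) = ∑ j, (toRat C (M i j) / toRat C e) • W j)
    {u : Polynomial C} (h : DenomReduces ℓ T W (polyσ C u * e)) : DenomReduces ℓ T W u := by
  intro p
  rw [← reducesTo_Smap_iff, Smap_sum_div_smul hSW]
  exact h _

lemma DenomReduces.of_polyσ_symm_mul {w : Polynomial C}
    {N : Matrix (Fin r) (Fin r) (Polynomial C)}
    (hN : ∀ i, Smap C ℓ r (∑ j, (toRat C (N i j) / toRat C w) • W j) = W i)
    {u : Polynomial C} (h : DenomReduces ℓ T W ((polyσ C).symm u * w)) :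
    DenomReduces ℓ T W u := by
  intro p
  have hb := h fun j => ∑ i, (polyσ C).symm (p i) * N i j
  rw [← reducesTo_Smap_iff] at hb
  convert hb using 1
  have hσ : ∀ i, toRat C (p i) / toRat C u =
      ratσ C (toRat C ((polyσ C).symm (p i)) / toRat C ((polyσ C).symm u)) := fun i => by
    rw [map_div₀, ratσ_toRat, ratσ_toRat, RingEquiv.apply_symm_apply, RingEquiv.apply_symm_apply]
  calc ∑ i, (toRat C (p i) / toRat C u) • W i
      = Smap C ℓ r (∑ i, (toRat C ((polyσ C).symm (p i)) / toRat C ((polyσ C).symm u)) •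
          ∑ j, (toRat C (N i j) / toRat C w) • W j) := by
        rw [Smap_sum]
        exact Finset.sum_congr rfl fun i _ => by rw [Smap_smul, hN, ← hσ]
    _ = _ := by
        congr 1
        simp only [Finset.smul_sum, smul_smul, map_sum, Finset.sum_div, Finset.sum_smul, map_mul]
        rw [Finset.sum_comm]
        exact Finset.sum_congr rfl fun j _ => Finset.sum_congr rfl fun i _ => by
          rw [div_mul_div_comm]

lemma isConjRoot_of_irreducible {q : Polynomial C} (hq : Irreducible q) {ξ η : Cbar C}
    (hξ : Polynomial.aeval ξ q = 0) (hη : Polynomial.aeval η q = 0) : IsConjRoot C ξ η :=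
  isConjRoot_def.mpr
    ((minpoly.eq_of_irreducible hq hξ).symm.trans (minpoly.eq_of_irreducible hq hη))

lemma RootsIn.pow {u : Polynomial C} (hu : RootsIn T u) (m : ℕ) : RootsIn T (u ^ m) := by
  induction m with
  | zero => simpa using rootsIn_one T
  | succ m ih => exact pow_succ u m ▸ ih.mul hu

lemma IsTransversal.rootsIn_of_irreducible (hT : IsTransversal T) {q : Polynomial C}
    (hq : Irreducible q) {ξ : Cbar C} (hξ : Polynomial.aeval ξ q = 0) (hξT : ξ ∈ T) :
    RootsIn T q :=
  ⟨hq.ne_zero, fun η hη => hT.conj_mem ξ η (isConjRoot_of_irreducible hq hξ hη) hξT⟩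

lemma DenomReduces.pow_of_sub_mem (hT : IsTransversal T) {e : Polynomial C}
    {M : Matrix (Fin r) (Fin r) (Polynomial C)}
    (hSW : ∀ i, Smap C ℓ r (W i) = ∑ j, (toRat C (M i j) / toRat C e) • W j)
    (he : RootsIn T e) (k : ℕ) {q : Polynomial C} (hq : Irreducible q) {ξ : Cbar C}
    (hξ : Polynomial.aeval ξ q = 0) (hk : ξ - (k : Cbar C) ∈ T) (m : ℕ) :
    DenomReduces ℓ T W (q ^ m) := by
  induction k generalizing q ξ with
  | zero => exact ((hT.rootsIn_of_irreducible hq hξ (by simpa using hk)).pow m).denomReduces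
  | succ k ih =>
    have hq' : Irreducible (polyσ C q) := (MulEquiv.irreducible_iff (polyσ C)).mpr hq
    refine DenomReduces.of_polyσ_mul hSW ?_
    rw [map_pow]
    by_cases hdvd : polyσ C q ∣ e
    · refine (RootsIn.mul (RootsIn.pow ⟨hq'.ne_zero, fun η hη => he.2 η ?_⟩ m) he).denomReduces
      exact Polynomial.aeval_eq_zero_of_dvd_aeval_eq_zero hdvd hη
    · refine DenomReduces.mul_of_isCoprime (pow_ne_zero _ hq'.ne_zero) he.1 ?_ he.denomReduces
        ((hq'.coprime_iff_not_dvd.mpr hdvd).pow_left)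
      refine ih hq' (ξ := ξ - 1) (by rwa [aeval_polyσ, sub_add_cancel]) ?_
      convert hk using 1
      push_cast
      ring

lemma DenomReduces.pow_of_add_mem (hT : IsTransversal T) {e : Polynomial C}
    {M : Matrix (Fin r) (Fin r) (Polynomial C)}
    (hSW : ∀ i, Smap C ℓ r (W i) = ∑ j, (toRat C (M i j) / toRat C e) • W j)
    (he : RootsIn T e) {w : Polynomial C} {N : Matrix (Fin r) (Fin r) (Polynomial C)}
    (hN : ∀ i, Smap C ℓ r (∑ j, (toRat C (N i j) / toRat C w) • W j) = W i)
    (hw : RootsIn T (polyσ C w)) (k : ℕ) {q : Polynomial C} (hq : Irreducible q) {ξ : Cbar C}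
    (hξ : Polynomial.aeval ξ q = 0) (hk : ξ + (k : Cbar C) ∈ T) (m : ℕ) :
    DenomReduces ℓ T W (q ^ m) := by
  induction k generalizing q ξ with
  | zero => exact ((hT.rootsIn_of_irreducible hq hξ (by simpa using hk)).pow m).denomReduces
  | succ k ih =>
    have hq' : Irreducible ((polyσ C).symm q) :=
      (MulEquiv.irreducible_iff (polyσ C).symm).mpr hq
    have hξ' : Polynomial.aeval (ξ + 1) ((polyσ C).symm q) = 0 := by rwa [aeval_polyσ_symm]
    have hw0 : w ≠ 0 := by
      rintro rfl
      exact hw.1 (map_zero _)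
    refine DenomReduces.of_polyσ_symm_mul hN ?_
    rw [map_pow]
    refine DenomReduces.mul_of_isCoprime (pow_ne_zero _ hq'.ne_zero) hw0 ?_
      (DenomReduces.of_polyσ_mul hSW (hw.mul he).denomReduces)
      (IsCoprime.pow_left (hq'.coprime_iff_not_dvd.mpr fun hdvd => ?_))
    · refine ih hq' hξ' ?_
      convert hk using 1
      push_cast
      ring
    · have h1 : ξ ∈ T := hw.2 ξ (by
        rw [aeval_polyσ]
        exact Polynomial.aeval_eq_zero_of_dvd_aeval_eq_zero hdvd hξ')
      have h2 := hT.eq_zero ξ ((k + 1 : ℕ) : ℤ) h1 (by exact_mod_cast hk)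
      omega

lemma denomReduces (hT : IsTransversal T) {e : Polynomial C}
    {M : Matrix (Fin r) (Fin r) (Polynomial C)}
    (hSW : ∀ i, Smap C ℓ r (W i) = ∑ j, (toRat C (M i j) / toRat C e) • W j)
    (he : RootsIn T e) {w : Polynomial C} {N : Matrix (Fin r) (Fin r) (Polynomial C)}
    (hN : ∀ i, Smap C ℓ r (∑ j, (toRat C (N i j) / toRat C w) • W j) = W i)
    (hw : RootsIn T (polyσ C w)) {u : Polynomial C} (hu : u ≠ 0) : DenomReduces ℓ T W u := by
  induction u using UniqueFactorizationMonoid.induction_on_coprime with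
  | h0 => exact absurd rfl hu
  | h1 hx =>
    exact RootsIn.denomReduces ⟨hu, fun ξ hξ => absurd (hx.map (Polynomial.aeval ξ)) (by simp [hξ])⟩
  | hpr m hq =>
    obtain ⟨ξ, hξ⟩ := IsAlgClosed.exists_aeval_eq_zero (Cbar C) _ hq.irreducible.degree_pos.ne'
    obtain ⟨k, hk⟩ := hT.exists_add_mem ξ
    obtain ⟨n, rfl | rfl⟩ := k.eq_nat_or_neg
    · exact DenomReduces.pow_of_add_mem hT hSW he hN hw n hq.irreducible hξ (by simpa using hk) m
    · exact DenomReduces.pow_of_sub_mem hT hSW he n hq.irreducible hξ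
        (by simpa [sub_eq_add_neg] using hk) m
  | hcp hxy ihx ihy =>
    have hx := left_ne_zero_of_mul hu
    have hy := right_ne_zero_of_mul hu
    exact (ihx hx).mul_of_isCoprime hx hy (ihy hy) (isRelPrime_iff_isCoprime.mp hxy)

end Reduction

theorem statement15 [NeZero r] (hr : 1 ≤ r) (hℓ : ℓ 0 * ℓ r ≠ 0) {I : ℕ}
    (D : SuitableData C ℓ r I) (W : Fin r → (Fin r → RatFunc C))
    (hW : IsSuitableBasis C ℓ r D W)
    (e : Polynomial C) (M : Matrix (Fin r) (Fin r) (Polynomial C)) (he : e ≠ 0)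
    (hSW : ∀ i, Smap C ℓ r (W i) = ∑ j, (toRat C (M i j) / toRat C e) • W j)
    (hgcd : ∀ d : Polynomial C, d ∣ e → (∀ i j, d ∣ M i j) → IsUnit d)
    (f : Fin r → RatFunc C) :
    ∃ (g : Fin r → RatFunc C) (d : Polynomial C) (P R : Fin r → Polynomial C),
      d ≠ 0 ∧
      f = Dmap C ℓ r g + (toRat C d)⁻¹ • (∑ i, toRat C (P i) • W i)
            + (toRat C e)⁻¹ • (∑ i, toRat C (R i) • W i) ∧
      (∀ i, (P i).degree < d.degree) ∧
      ShiftFree (d.map (algebraMap C (Cbar C)) * ∏ i, (X - Polynomial.C (D.β i))) ∧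
      (IsSummable C ℓ r f → ∀ i, P i = 0) := by
  obtain ⟨h0, hr0⟩ := mul_ne_zero_iff.mp hℓ
  obtain ⟨T, hT, hβT⟩ := exists_isTransversal D.β fun _ _ _ => D.eq_zero_of_isConjRoot
  by_cases hf : IsSummable C ℓ r f
  · obtain ⟨g, hg⟩ := hf
    exact ⟨g, 1, 0, 0, one_ne_zero, by simpa using hg, by simp,
      hT.shiftFree_map_mul_prod hβT (rootsIn_one T), fun _ _ => rfl⟩
  obtain ⟨w, N, hw, hN⟩ := hW.exists_inverse h0 hr0 hβT
  have hmem : f ∈ Submodule.span (RatFunc C) (Set.range W) := hW.1.2 ▸ Submodule.mem_top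
  obtain ⟨a, ha⟩ := (Submodule.mem_span_range_iff_exists_fun _).mp hmem
  obtain ⟨p, hp⟩ := exists_eq_div_prod_denom a
  obtain ⟨g, d, P, hd, hgd⟩ := denomReduces hT hSW (hW.rootsIn hr0 hβT he hSW hgcd) hN hw
    (Finset.prod_ne_zero_iff.mpr fun j _ => (a j).denom_ne_zero) p
  have hfa : f = ∑ i, (toRat C (p i) / toRat C (∏ j, (a j).denom)) • W i := by
    rw [← ha]
    exact Finset.sum_congr rfl fun i _ => by rw [← hp]
  rw [← hfa] at hgd
  refine ⟨g, d, fun i => P i % d, fun i => P i / d * e, hd.1, ?_,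
    fun i => Polynomial.degree_mod_lt _ hd.1, hT.shiftFree_map_mul_prod hβT hd,
    fun h => absurd h hf⟩
  rw [hgd, add_assoc, Finset.smul_sum, Finset.smul_sum, ← Finset.sum_add_distrib]
  congr 1
  refine Finset.sum_congr rfl fun i _ => ?_
  rw [smul_smul, smul_smul, ← add_smul]
  congr 1
  have hd' := toRat_ne_zero hd.1
  have he' := toRat_ne_zero he
  have hdiv : toRat C (P i) = toRat C d * toRat C (P i / d) + toRat C (P i % d) := by
    rw [← map_mul, ← map_add, EuclideanDomain.div_add_mod]
  rw [hdiv, map_mul]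
  field_simp
  ring

end PRec
end
end

section
/- Let g ∈ C(x) be a nonzero rational function with ν_∞(g) ≠ 0. Then Δ(g) := σ(g) − g is nonzero and ν_∞(Δ(g)) = ν_∞(g) + 1. -/
set_option maxHeartbeats 1000000
set_option synthInstance.maxHeartbeats 200000

open Polynomial Filter

noncomputable section

namespace PRec

variable (C : Type*) [Field C] [CharZero C]

variable (ℓ : ℕ → Polynomial C) (r : ℕ)

variable [NeZero r]

/-- The valuation at infinity of a rational function, `ν_∞(p/q) = deg q - deg p`. -/
def nuInf (g : RatFunc C) : ℤ := (g.denom.natDegree : ℤ) - (g.num.natDegree : ℤ)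

/-- `x * (p(x+1) - p(x))` has degree at most `deg p`. -/
theorem natDegree_X_mul_shift_sub_le {K : Type*} [Field K] (p : Polynomial K) :
    (X * (taylor 1 p - p)).natDegree ≤ p.natDegree := by
  rw [natDegree_le_iff_coeff_eq_zero]
  rintro (_ | j) hj
  · omega
  rw [coeff_X_mul, coeff_sub]
  rcases (Nat.lt_succ_iff.mp hj).eq_or_lt with h | h
  · rw [← h, coeff_taylor_natDegree, leadingCoeff, sub_self]
  · rw [coeff_eq_zero_of_natDegree_lt h,
      coeff_eq_zero_of_natDegree_lt ((natDegree_taylor p (1 : K)).trans_lt h), sub_self]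

/-- The coefficient of `x * (p(x+1) - p(x))` at `deg p`. -/
theorem coeff_X_mul_shift_sub {K : Type*} [Field K] (p : Polynomial K) :
    (X * (taylor 1 p - p)).coeff p.natDegree = p.natDegree * p.leadingCoeff := by
  rcases hn : p.natDegree with _ | k
  · simp
  have hd : (hasseDeriv k p).natDegree ≤ 1 :=
    (natDegree_hasseDeriv_le p k).trans (by omega)
  rw [coeff_X_mul, coeff_sub, taylor_coeff, eq_X_add_C_of_natDegree_le_one hd]
  simp [hasseDeriv_coeff, leadingCoeff, hn, add_comm 1 k]

/-- The numerator of the difference of a fraction with `deg p ≠ deg q` has degree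
`deg p + deg q - 1`. -/
theorem natDegree_shift_cross_sub {K : Type*} [Field K] [CharZero K] {p q : Polynomial K}
    (hp : p ≠ 0) (hq : q ≠ 0) (hpq : p.natDegree ≠ q.natDegree) :
    taylor 1 p * q - p * taylor 1 q ≠ 0 ∧
      (taylor 1 p * q - p * taylor 1 q).natDegree + 1 = p.natDegree + q.natDegree := by
  have key : X * (taylor 1 p * q - p * taylor 1 q) =
      (X * (taylor 1 p - p)) * q - p * (X * (taylor 1 q - q)) := by ring
  have hle : (X * (taylor 1 p * q - p * taylor 1 q)).natDegree ≤
      p.natDegree + q.natDegree := by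
    rw [key]
    exact (natDegree_sub_le_of_le
      (natDegree_mul_le_of_le (natDegree_X_mul_shift_sub_le p) le_rfl)
      (natDegree_mul_le_of_le le_rfl (natDegree_X_mul_shift_sub_le q))).trans_eq (max_self _)
  have hc : (X * (taylor 1 p * q - p * taylor 1 q)).coeff (p.natDegree + q.natDegree) ≠ 0 := by
    rw [key, coeff_sub,
      coeff_mul_add_eq_of_natDegree_le (natDegree_X_mul_shift_sub_le p) le_rfl,
      coeff_mul_add_eq_of_natDegree_le le_rfl (natDegree_X_mul_shift_sub_le q),
      coeff_X_mul_shift_sub, coeff_X_mul_shift_sub, coeff_natDegree, coeff_natDegree]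
    have hne : (p.natDegree : K) - q.natDegree ≠ 0 :=
      sub_ne_zero.mpr (Nat.cast_injective.ne hpq)
    have := mul_ne_zero hne
      (mul_ne_zero (leadingCoeff_ne_zero.mpr hp) (leadingCoeff_ne_zero.mpr hq))
    convert this using 1
    ring
  have h0 : taylor 1 p * q - p * taylor 1 q ≠ 0 := by
    intro h
    simp [h] at hc
  exact ⟨h0, by rw [← natDegree_X_mul h0]; exact natDegree_eq_of_le_of_coeff_ne_zero hle hc⟩

theorem nuInf_eq_neg_intDegree {K : Type*} [Field K] (g : RatFunc K) : nuInf K g = -g.intDegree := by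
  simp [nuInf, RatFunc.intDegree]

theorem ratσ_eq_div {K : Type*} [Field K] (g : RatFunc K) :
    ratσ K g =
      toRat K (taylor 1 g.num) / toRat K (taylor 1 g.denom) := by
  conv_lhs => rw [← RatFunc.num_div_denom g, map_div₀]
  simp [ratσ, RatFunc.coe_mapRingHom_eq_coe_map, RatFunc.map_apply, polyσ, polyShiftEquiv,
    taylor_apply]

theorem statement17 (g : RatFunc C) (hg : g ≠ 0) (hval : nuInf C g ≠ 0) :
    ratσ C g - g ≠ 0 ∧ nuInf C (ratσ C g - g) = nuInf C g + 1 := by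
  have hp : g.num ≠ 0 := RatFunc.num_ne_zero hg
  have hq : g.denom ≠ 0 := g.denom_ne_zero
  have hpq : g.num.natDegree ≠ g.denom.natDegree := by
    intro h
    simp [nuInf, h] at hval
  obtain ⟨hN, hdeg⟩ := natDegree_shift_cross_sub hp hq hpq
  have hq' : taylor 1 g.denom ≠ 0 := (taylor_eq_zero _ _).not.mpr hq
  have hinj {a : Polynomial C} (ha : a ≠ 0) : toRat C a ≠ 0 := RatFunc.algebraMap_ne_zero ha
  have hD := mul_ne_zero hq' hq
  have heq : ratσ C g - g =
      toRat C (taylor 1 g.num * g.denom - g.num * taylor 1 g.denom) *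
        (toRat C (taylor 1 g.denom * g.denom))⁻¹ := by
    have hg' : g = toRat C g.num / toRat C g.denom := (RatFunc.num_div_denom g).symm
    rw [ratσ_eq_div]
    nth_rewrite 3 [hg']
    rw [div_sub_div _ _ (hinj hq') (hinj hq), div_eq_mul_inv]
    simp only [map_sub, map_mul]
    ring
  refine ⟨heq ▸ mul_ne_zero (hinj hN) (inv_ne_zero (hinj hD)), ?_⟩
  rw [nuInf_eq_neg_intDegree, heq, RatFunc.intDegree_mul (hinj hN) (inv_ne_zero (hinj hD)),
    RatFunc.intDegree_inv, RatFunc.intDegree_polynomial, RatFunc.intDegree_polynomial,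
    natDegree_mul hq' hq, natDegree_taylor, nuInf]
  omega

end PRec
end
end
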